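/- Let d be a positive integer. The map Ψ sending a maximal submodule M ⊆ S_ν^d to the pair (M_π, M_u), where M_π (resp. M_u) is the S_{ν,π}-submodule (resp. S_{ν,u}-submodule) of E^d generated by M, is an injective map from the set of maximal submodules of S_ν^d to pairs of free submodules of S_{ν,π}^d and S_{ν,u}^d. Its image consists exactly of the pairs (A, B) such that A and B generate the same E-subspace of E^d, and for such a pair the unique preimage is A ∩ B. Moreover, for maximal submodules M, M' of S_ν^d: Ψ(M ∩ M') = (M_π ∩ M'_π, M_u ∩ M'_u) and Ψ(Max(M + M')) = (M_π + M'_π, M_u + M'_u). -/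

import Mathlib

noncomputable section

/-- Lift of `WithTop ℤ` (the value monoid of the valuation of `K`) into `EReal`. -/
def toE (t : WithTop ℤ) : EReal :=
  WithTop.recTopCoe ⊤ (fun n : ℤ => ((n : ℝ) : EReal)) t

variable {K : Type} [Field K]

/-- For a formal Laurent series given by its coefficient function
`f : ℤ → K`, the quantity `v_K(f i) + ν·i ∈ EReal`. -/
def lterm (vK : K → WithTop ℤ) (ν : ℚ) (f : ℤ → K) (i : ℤ) : EReal :=
  toE (vK (f i)) + (((ν * i : ℚ) : ℝ) : EReal)

/-- The Gauss valuation `v_ν(f) = inf_{i ∈ ℤ} (v_K(f i) + ν·i)` of a formal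
Laurent series. -/
def vGL (vK : K → WithTop ℤ) (ν : ℚ) (f : ℤ → K) : EReal :=
  ⨅ i : ℤ, lterm vK ν f i

/-- Partial sums approximating the `n`-th coefficient of the product of two
formal Laurent series. -/
def psum (f g : ℤ → K) (n : ℤ) (N : ℕ) : K :=
  ∑ i ∈ Finset.Icc (-(N : ℤ)) (N : ℤ), f i * g (n - i)

/-- Multiplication of formal Laurent series: the `n`-th coefficient is the
limit (with respect to the valuation `vK`) of the partial sums
`Σ_{|i| ≤ N} f i · g (n−i)`, when this limit exists (and `0` otherwise). -/
def mulL (vK : K → WithTop ℤ) (f g : ℤ → K) : ℤ → K := fun n =>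
  @dite K
    (∃ l : K, ∀ m : ℤ, ∃ N0 : ℕ, ∀ N : ℕ, N0 ≤ N →
      (m : WithTop ℤ) ≤ vK (psum f g n N - l))
    (Classical.propDecidable _) (fun h => h.choose) (fun _ => 0)

/-- The Laurent series `1`. -/
def oneL : ℤ → K := fun n => if n = 0 then 1 else 0

/-- Scalar multiplication of a vector of Laurent series by a Laurent series. -/
def smulV (vK : K → WithTop ℤ) {d : ℕ} (r : ℤ → K) (x : Fin d → ℤ → K) :
    Fin d → ℤ → K :=
  fun k => mulL vK r (x k)

/-- The set of finite `R`-linear combinations of elements of `X`: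
the `R`-module generated by `X` inside the `d`-dimensional Laurent space. -/
def SpanL (vK : K → WithTop ℤ) (d : ℕ) (R : Set (ℤ → K))
    (X : Set (Fin d → ℤ → K)) : Set (Fin d → ℤ → K) :=
  {y | ∃ (m : ℕ) (r : Fin m → ℤ → K) (v : Fin m → Fin d → ℤ → K),
    (∀ j, r j ∈ R) ∧ (∀ j, v j ∈ X) ∧
    y = fun k n => ∑ j, mulL vK (r j) (v j k) n}

/-- `M` is an `R`-submodule: contains `0` and is stable under addition and
under multiplication by scalars from `R`. -/
def IsSubmodL (vK : K → WithTop ℤ) (d : ℕ) (R : Set (ℤ → K))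
    (M : Set (Fin d → ℤ → K)) : Prop :=
  (fun _ _ => (0 : K)) ∈ M ∧
  (∀ x ∈ M, ∀ y ∈ M, (fun k n => x k n + y k n) ∈ M) ∧
  (∀ r ∈ R, ∀ x ∈ M, smulV vK r x ∈ M)

/-- `M` is a free `R`-module: it admits a finite basis. -/
def IsFreeL (vK : K → WithTop ℤ) (d : ℕ) (R : Set (ℤ → K))
    (M : Set (Fin d → ℤ → K)) : Prop :=
  ∃ (m : ℕ) (b : Fin m → Fin d → ℤ → K),
    (∀ j, b j ∈ M) ∧ M = SpanL vK d R (Set.range b) ∧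
    ∀ r : Fin m → ℤ → K, (∀ j, r j ∈ R) →
      (fun k n => ∑ j, mulL vK (r j) (b j k) n) = (fun _ _ => (0 : K)) →
      ∀ j, r j = fun _ => 0

/-- `S_ν`, viewed inside formal Laurent series: support in `ℕ` and
`v_K(aᵢ) + ν·i ≥ 0`. -/
def SnuLSet (vK : K → WithTop ℤ) (ν : ℚ) : Set (ℤ → K) :=
  {f | (∀ i : ℤ, i < 0 → f i = 0) ∧ ∀ i : ℤ, 0 ≤ lterm vK ν f i}

/-- `S_{ν,π} = S_ν[1/π]`, viewed inside formal Laurent series. -/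
def SnupiLSet (vK : K → WithTop ℤ) (ν : ℚ) : Set (ℤ → K) :=
  {f | (∀ i : ℤ, i < 0 → f i = 0) ∧
    ∃ c : ℚ, ∀ i : ℤ, ((c : ℝ) : EReal) ≤ lterm vK ν f i}

/-- `S_{ν,u}`: Laurent series with `v_K(aᵢ) + ν·i ≥ 0` everywhere, tending to
`+∞` as `i → −∞`. -/
def SnuuLSet (vK : K → WithTop ℤ) (ν : ℚ) : Set (ℤ → K) :=
  {f | (∀ i : ℤ, 0 ≤ lterm vK ν f i) ∧
    ∀ m : ℚ, ∃ N : ℤ, ∀ i : ℤ, i ≤ N → ((m : ℝ) : EReal) ≤ lterm vK ν f i}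

/-- The field `E`: Laurent series with `v_K(aᵢ) + ν·i` bounded below, tending
to `+∞` as `i → −∞`. -/
def ELSet (vK : K → WithTop ℤ) (ν : ℚ) : Set (ℤ → K) :=
  {f | (∃ c : ℚ, ∀ i : ℤ, ((c : ℝ) : EReal) ≤ lterm vK ν f i) ∧
    ∀ m : ℚ, ∃ N : ℤ, ∀ i : ℤ, i ≤ N → ((m : ℝ) : EReal) ≤ lterm vK ν f i}

/-- The uniformizer `π`, as a Laurent series. -/
def piL (πK : K) : ℤ → K := fun i => if i = 0 then πK else 0

/-- The element `u^α/π^β`, as a Laurent series. -/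
def wLs (πK : K) (α : ℕ) (β : ℤ) : ℤ → K :=
  fun i => if i = (α : ℤ) then πK ^ (-β) else 0

/-- Powers of a Laurent series. -/
def powL (vK : K → WithTop ℤ) (f : ℤ → K) : ℕ → (ℤ → K)
  | 0 => oneL
  | n + 1 => mulL vK f (powL vK f n)

/-- `Max(N) = {x ∈ S_ν^d : ∃ n, π^n x ∈ N and (u^α/π^β)^n x ∈ N}`. -/
def MaxOfL (vK : K → WithTop ℤ) (ν : ℚ) (d : ℕ) (πK : K) (α : ℕ) (β : ℤ)
    (N : Set (Fin d → ℤ → K)) : Set (Fin d → ℤ → K) :=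
  {x | (∀ k, x k ∈ SnuLSet vK ν) ∧
    ∃ n : ℕ, smulV vK (powL vK (piL πK) n) x ∈ N ∧
      smulV vK (powL vK (wLs πK α β) n) x ∈ N}

/-- `M` is a maximal (finitely generated) sub-`S_ν`-module of `S_ν^d`. -/
def IsMaxSubL (vK : K → WithTop ℤ) (ν : ℚ) (d : ℕ) (πK : K) (α : ℕ) (β : ℤ)
    (M : Set (Fin d → ℤ → K)) : Prop :=
  (∀ x ∈ M, ∀ k, x k ∈ SnuLSet vK ν) ∧
  IsSubmodL vK d (SnuLSet vK ν) M ∧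
  (∃ (m : ℕ) (b : Fin m → Fin d → ℤ → K),
    (∀ j, b j ∈ M) ∧ M = SpanL vK d (SnuLSet vK ν) (Set.range b)) ∧
  M = MaxOfL vK ν d πK α β M

/-- The sum `M + M'` of two sets of vectors. -/
def sumV {d : ℕ} (M M' : Set (Fin d → ℤ → K)) : Set (Fin d → ℤ → K) :=
  {z | ∃ x ∈ M, ∃ y ∈ M', z = fun k n => x k n + y k n}


namespace Gluing

open Submodule

section Coordinates

variable {E : Type*} [CommRing E] (R : Subring E) (d : ℕ)

/-- The inclusion `R^d → E^d`. -/
def inclPi : (Fin d → R) →ₗ[R] (Fin d → E) where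
  toFun x k := x k
  map_add' _ _ := rfl
  map_smul' _ _ := rfl

variable {R d}

lemma inclPi_injective : Function.Injective (inclPi R d) := fun _ _ h =>
  funext fun k => Subtype.ext (congrFun h k)

lemma map_comap_inclPi {L : Submodule R (Fin d → E)} (hL : ∀ x ∈ L, ∀ k, x k ∈ R) :
    (L.comap (inclPi R d)).map (inclPi R d) = L := by
  apply map_comap_eq_self
  intro x hx
  exact ⟨fun k => ⟨x k, hL x hx k⟩, rfl⟩

lemma fg_of_coords [IsNoetherianRing R] {L : Submodule R (Fin d → E)}
    (hL : ∀ x ∈ L, ∀ k, x k ∈ R) : L.FG := by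
  rw [← map_comap_inclPi hL]
  exact (IsNoetherian.noetherian _).map _

lemma exists_basis_of_coords [IsDomain E] [IsPrincipalIdealRing R]
    {L : Submodule R (Fin d → E)} (hL : ∀ x ∈ L, ∀ k, x k ∈ R) :
    ∃ (n : ℕ) (b : Fin n → Fin d → E), span R (Set.range b) = L ∧ LinearIndependent R b := by
  obtain ⟨n, ⟨b⟩⟩ := Submodule.nonempty_basis_of_pid (Pi.basisFun R (Fin d))
    (L.comap (inclPi R d))
  refine ⟨n, fun i => inclPi R d (b i), ?_, ?_⟩
  · have h1 : span R (Set.range fun i => ((b i : L.comap (inclPi R d)) : Fin d → R)) =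
        L.comap (inclPi R d) := by
      have := congrArg (Submodule.map (L.comap (inclPi R d)).subtype) b.span_eq
      rw [Submodule.map_span, ← Set.range_comp] at this
      simpa [Function.comp_def] using this
    have h2 := map_comap_inclPi hL
    rw [← h1, Submodule.map_span, ← Set.range_comp] at h2
    exact h2
  · have h1 := b.linearIndependent
    have h2 := h1.map' (L.comap (inclPi R d)).subtype (by simp)
    exact h2.map' (inclPi R d) (LinearMap.ker_eq_bot.2 inclPi_injective)

/-- Scalar extension along a flat inclusion of domains commutes with intersections. -/
lemma mem_span_inter_of_mem [IsDomain E] [IsPrincipalIdealRing R]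
    {A A' : Submodule R (Fin d → E)} (hA : ∀ x ∈ A, ∀ k, x k ∈ R)
    (hA' : ∀ x ∈ A', ∀ k, x k ∈ R) {x : Fin d → E}
    (hx : x ∈ span E (A : Set (Fin d → E))) (hx' : x ∈ span E (A' : Set (Fin d → E))) :
    x ∈ span E ((A : Set (Fin d → E)) ∩ A') := by
  have hflat : Module.Flat R E := inferInstance
  obtain ⟨n, e, a, rfl⟩ := Submodule.mem_span_set'.1 hx
  obtain ⟨n', e', a', hx'⟩ := Submodule.mem_span_set'.1 hx'
  let g : (Fin n ⊕ Fin n') → Fin d → R := Sum.elim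
    (fun i k => ⟨(a i : Fin d → E) k, hA _ (a i).2 k⟩)
    (fun i k => - ⟨(a' i : Fin d → E) k, hA' _ (a' i).2 k⟩)
  let c : (Fin n ⊕ Fin n') → E := Sum.elim e e'
  let f : (Fin d → R) →ₗ[R] ((Fin n ⊕ Fin n') → R) :=
    Fintype.linearCombination R (fun k i => g i k)
  let y : ((Fin n ⊕ Fin n') → R) →ₗ[R] E := Fintype.linearCombination R c
  have h0 : y ∘ₗ f = 0 := by
    apply LinearMap.pi_ext'
    intro k
    ext
    have := congrFun hx' k
    simp [f, y, Fintype.linearCombination_apply, g, c, Subring.smul_def,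
      Pi.single_apply, ite_smul] at this ⊢
    rw [← sub_eq_zero] at this
    rw [← neg_eq_zero, ← this]
    simp only [mul_comm]
    ring
  obtain ⟨m, l, z, hz, hl⟩ := Module.Flat.exists_factorization_of_comp_eq_zero_of_free h0
  have hc : ∀ i, c i = ∑ j, ((l (Pi.single i 1) j : R) : E) * z (Finsupp.single j 1) := by
    intro i
    have h1 : y (Pi.single i 1) = c i := by
      simp [y]
    rw [← h1, hz, LinearMap.comp_apply]
    conv_lhs => rw [← Finsupp.univ_sum_single (l (Pi.single i 1)), map_sum]
    refine Finset.sum_congr rfl fun j _ => ?_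
    rw [← smul_eq_mul, ← Subring.smul_def, ← map_smul, Finsupp.smul_single, smul_eq_mul, mul_one]
  have hl' : ∀ k j, ∑ i, g i k * l (Pi.single i 1) j = 0 := by
    intro k j
    have h1 := congrArg (fun v => v j) (LinearMap.congr_fun hl (Pi.single k 1))
    have h2 : f (Pi.single k 1) = ∑ i, g i k • Pi.single i (1 : R) := by
      ext i
      simp [f, Pi.single_apply]
    simp only [LinearMap.comp_apply, h2, map_sum, map_smul] at h1
    simpa [Finsupp.finsetSum_apply] using h1
  let w : Fin m → Fin d → E := fun j => ∑ i, l (Pi.single (Sum.inl i) 1) j • (a i : Fin d → E)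
  have hw : ∀ j, w j ∈ (A : Set (Fin d → E)) ∩ A' := by
    intro j
    refine ⟨A.sum_mem fun i _ => A.smul_mem _ (a i).2, ?_⟩
    have : w j = ∑ i, l (Pi.single (Sum.inr i) 1) j • (a' i : Fin d → E) := by
      ext k
      have h1 := congrArg (Subtype.val) (hl' k j)
      simp [g] at h1
      simp [w, Subring.smul_def]
      rw [← sub_eq_zero, ← h1]
      simp only [mul_comm]
      ring
    rw [this]
    exact A'.sum_mem fun i _ => A'.smul_mem _ (a' i).2
  have : ∑ i, e i • (a i : Fin d → E) = ∑ j, z (Finsupp.single j 1) • w j := by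
    have h1 : ∀ i, e i = c (Sum.inl i) := fun i => rfl
    simp only [h1, hc, w, Finset.sum_smul, Finset.smul_sum, Subring.smul_def, smul_smul]
    rw [Finset.sum_comm]
    simp only [mul_comm]
  rw [this]
  exact Submodule.sum_mem _ fun j _ => smul_mem _ _ (subset_span (hw j))

end Coordinates

section Core

variable {E W : Type*} [CommRing E] [AddCommGroup W] [Module E W]

/-- The relations between `S_ν`, `S_{ν,π}`, `S_{ν,u}` and `E` used to glue modules: `S = P ∩ U`,
`π` is a unit of `P`, `E = U[1/π]`, `X` is a unit of `U` and `P[1/X]` is `π`-adically dense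
in `E`. -/
structure IsGluing (S P U : Subring E) (π X : E) : Prop where
  mem_iff : ∀ e, e ∈ S ↔ e ∈ P ∧ e ∈ U
  pi_mem : π ∈ S
  X_mem : X ∈ S
  exists_pi_inv : ∃ y ∈ P, y * π = 1
  exists_X_inv : ∃ y ∈ U, y * X = 1
  exists_pow_mem : ∀ e, ∃ n : ℕ, π ^ n * e ∈ U
  approx : ∀ (e : E) (m : ℕ), ∃ g ∈ U, ∃ k : ℕ, X ^ k * (e - π ^ m * g) ∈ P

variable {S P U : Subring E} {π X : E}

lemma smul_mem_of_mem {R : Subring E} (N : Submodule R W) {r : E} (hr : r ∈ R) {x : W}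
    (hx : x ∈ N) : r • x ∈ N :=
  N.smul_mem (⟨r, hr⟩ : R) hx

lemma mem_of_smul_mem {R : Subring E} (N : Submodule R W) {r : E} (hr : ∃ y ∈ R, y * r = 1)
    {x : W} (n : ℕ) (hx : r ^ n • x ∈ N) : x ∈ N := by
  obtain ⟨y, hy, h⟩ := hr
  have := smul_mem_of_mem N (R.pow_mem hy n) hx
  rwa [smul_smul, ← mul_pow, h, one_pow, one_smul] at this

namespace IsGluing

variable (hG : IsGluing S P U π X)
include hG

lemma memP {s : E} (hs : s ∈ S) : s ∈ P := ((hG.mem_iff s).1 hs).1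

lemma memU {s : E} (hs : s ∈ S) : s ∈ U := ((hG.mem_iff s).1 hs).2

/-- The intersection of a `P`-submodule and a `U`-submodule, as an `S`-submodule. -/
def inter (A : Submodule P W) (B : Submodule U W) : Submodule S W where
  carrier := (A : Set W) ∩ B
  zero_mem' := ⟨A.zero_mem, B.zero_mem⟩
  add_mem' hx hy := ⟨A.add_mem hx.1 hy.1, B.add_mem hx.2 hy.2⟩
  smul_mem' s _ hx := ⟨smul_mem_of_mem A (hG.memP s.2) hx.1, smul_mem_of_mem B (hG.memU s.2) hx.2⟩

omit hG in
lemma span_le_span_top {R : Subring E} (N : Set W) {x : W}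
    (hx : x ∈ span R N) : x ∈ span E N := by
  induction hx using Submodule.span_induction with
  | mem x hx => exact subset_span hx
  | zero => exact Submodule.zero_mem _
  | add x y _ _ hx hy => exact Submodule.add_mem _ hx hy
  | smul r x _ hx => exact Submodule.smul_mem _ (r : E) hx

omit hG in
lemma span_span_top (R : Subring E) (N : Set W) :
    span E (span R N : Set W) = span E N := by
  apply le_antisymm
  · rw [span_le]
    exact fun x hx => span_le_span_top _ hx
  · exact span_mono subset_span

lemma exists_pow_smul_mem_span {N : Set W} {x : W} (hx : x ∈ span E N) :
    ∃ n : ℕ, π ^ n • x ∈ span U N := by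
  have hpi : π ∈ U := hG.memU hG.pi_mem
  induction hx using Submodule.span_induction with
  | mem x hx => exact ⟨0, by simpa using subset_span hx⟩
  | zero => exact ⟨0, by simp⟩
  | add x y _ _ hx hy =>
    obtain ⟨n, hn⟩ := hx
    obtain ⟨m, hm⟩ := hy
    refine ⟨n + m, ?_⟩
    rw [smul_add, pow_add]
    refine Submodule.add_mem _ ?_ ?_
    · rw [mul_comm, mul_smul]; exact smul_mem_of_mem _ (U.pow_mem hpi m) hn
    · rw [mul_smul]; exact smul_mem_of_mem _ (U.pow_mem hpi n) hm
  | smul e x _ hx =>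
    obtain ⟨n, hn⟩ := hx
    obtain ⟨m, hm⟩ := hG.exists_pow_mem e
    refine ⟨m + n, ?_⟩
    rw [smul_smul, pow_add, mul_right_comm, mul_smul]
    exact smul_mem_of_mem _ hm hn

lemma exists_pow_smul_mem {N : Submodule S W} {x : W} (hx : x ∈ span P (N : Set W)) :
    ∃ n : ℕ, π ^ n • x ∈ N := by
  have hpi : π ∈ S := hG.pi_mem
  induction hx using Submodule.span_induction with
  | mem x hx => exact ⟨0, by simpa using hx⟩
  | zero => exact ⟨0, by simp⟩
  | add x y _ _ hx hy =>
    obtain ⟨n, hn⟩ := hx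
    obtain ⟨m, hm⟩ := hy
    refine ⟨n + m, ?_⟩
    rw [smul_add, pow_add]
    refine Submodule.add_mem _ ?_ ?_
    · rw [mul_comm, mul_smul]; exact smul_mem_of_mem _ (S.pow_mem hpi m) hn
    · rw [mul_smul]; exact smul_mem_of_mem _ (S.pow_mem hpi n) hm
  | smul e x _ hx =>
    obtain ⟨n, hn⟩ := hx
    obtain ⟨m, hm⟩ := hG.exists_pow_mem e
    refine ⟨m + n, ?_⟩
    rw [Subring.smul_def, smul_smul, pow_add, mul_right_comm, mul_smul]
    exact smul_mem_of_mem _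
      ((hG.mem_iff _).2 ⟨P.mul_mem (P.pow_mem (hG.memP hpi) m) e.2, hm⟩) hn

lemma exists_eq_add_of_mem_span {N : Submodule S W} {x : W} (hx : x ∈ span U (N : Set W))
    (m : ℕ) : ∃ k : ℕ, ∃ y ∈ N, ∃ z ∈ span U (N : Set W), X ^ k • x = y + π ^ m • z := by
  induction hx using Submodule.span_induction with
  | mem x hx => exact ⟨0, x, hx, 0, Submodule.zero_mem _, by simp⟩
  | zero => exact ⟨0, 0, N.zero_mem, 0, Submodule.zero_mem _, by simp⟩
  | add x x' _ _ hx hx' =>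
    obtain ⟨k, y, hy, z, hz, h⟩ := hx
    obtain ⟨k', y', hy', z', hz', h'⟩ := hx'
    refine ⟨k + k', X ^ k' • y + X ^ k • y', ?_, X ^ k' • z + X ^ k • z', ?_, ?_⟩
    · exact N.add_mem (smul_mem_of_mem _ (S.pow_mem hG.X_mem _) hy)
        (smul_mem_of_mem _ (S.pow_mem hG.X_mem _) hy')
    · exact Submodule.add_mem _ (smul_mem_of_mem _ (U.pow_mem (hG.memU hG.X_mem) _) hz)
        (smul_mem_of_mem _ (U.pow_mem (hG.memU hG.X_mem) _) hz')
    · have : X ^ (k + k') • (x + x') = X ^ k' • (X ^ k • x) + X ^ k • (X ^ k' • x') := by module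
      rw [this, h, h']
      module
  | smul t x _ hx =>
    obtain ⟨k, y, hy, z, hz, h⟩ := hx
    obtain ⟨g, hg, l, hl⟩ := hG.approx (t : E) m
    have hXU : X ∈ U := hG.memU hG.X_mem
    have hpU : π ∈ U := hG.memU hG.pi_mem
    have hlS : X ^ l * ((t : E) - π ^ m * g) ∈ S := (hG.mem_iff _).2 ⟨hl,
      U.mul_mem (U.pow_mem hXU _) (U.sub_mem t.2 (U.mul_mem (U.pow_mem hpU _) hg))⟩
    refine ⟨k + l, (X ^ l * ((t : E) - π ^ m * g)) • y, smul_mem_of_mem _ hlS hy,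
      (X ^ l * g) • y + (X ^ l * t) • z, Submodule.add_mem _ ?_ ?_, ?_⟩
    · exact smul_mem_of_mem _ (U.mul_mem (U.pow_mem hXU _) hg) (subset_span hy)
    · exact smul_mem_of_mem _ (U.mul_mem (U.pow_mem hXU _) t.2) hz
    · rw [Subring.smul_def]
      have : X ^ (k + l) • ((t : E) • x) = (X ^ l * (t : E)) • (X ^ k • x) := by module
      rw [this, h]
      module

/-- A finitely generated `S`-module killed into `N` by powers of `π` elementwise is so
uniformly. -/
lemma exists_uniform_pow {N L : Submodule S W} (hL : L.FG)
    (h : ∀ x ∈ L, ∃ n : ℕ, π ^ n • x ∈ N) : ∃ n : ℕ, ∀ x ∈ L, π ^ n • x ∈ N := by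
  classical
  obtain ⟨s, rfl⟩ := hL
  choose! n hn using fun x (hx : x ∈ s) => h x (subset_span hx)
  refine ⟨∑ x ∈ s, n x, fun x hx => ?_⟩
  induction hx using Submodule.span_induction with
  | mem x hx =>
    rw [← Finset.sum_erase_add _ _ hx, pow_add, mul_smul]
    exact smul_mem_of_mem _ (S.pow_mem hG.pi_mem _) (hn x hx)
  | zero => simp
  | add x y _ _ hx hy => rw [smul_add]; exact N.add_mem hx hy
  | smul r x _ hx =>
    rw [Subring.smul_def, smul_comm]
    exact smul_mem_of_mem _ r.2 hx

/-- `N_π ∩ N_u` is the set of elements pushed into `N` by powers of both `π` and `X`. -/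
lemma mem_inter_span_iff {N : Submodule S W}
    (hfg : (hG.inter (span P (N : Set W)) (span U (N : Set W))).FG) (x : W) :
    (x ∈ span P (N : Set W) ∧ x ∈ span U (N : Set W)) ↔
      ∃ n : ℕ, π ^ n • x ∈ N ∧ X ^ n • x ∈ N := by
  constructor
  · rintro ⟨hP, hU⟩
    obtain ⟨n, hn⟩ := hG.exists_pow_smul_mem hP
    obtain ⟨m, hm⟩ := hG.exists_uniform_pow hfg fun x hx => hG.exists_pow_smul_mem hx.1
    obtain ⟨k, y, hy, z, hz, h⟩ := hG.exists_eq_add_of_mem_span hU m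
    have hzP : z ∈ span P (N : Set W) := by
      apply mem_of_smul_mem _ hG.exists_pi_inv m
      have : π ^ m • z = X ^ k • x - y := by rw [h]; abel
      rw [this]
      exact Submodule.sub_mem _
        (smul_mem_of_mem _ (P.pow_mem (hG.memP hG.X_mem) k) hP) (subset_span hy)
    have hk : X ^ k • x ∈ N := by
      rw [h]
      exact N.add_mem hy (hm z ⟨hzP, hz⟩)
    refine ⟨n + k, ?_, ?_⟩
    · rw [pow_add, mul_comm, mul_smul]
      exact smul_mem_of_mem _ (S.pow_mem hG.pi_mem _) hn
    · rw [pow_add, mul_smul]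
      exact smul_mem_of_mem _ (S.pow_mem hG.X_mem _) hk
  · rintro ⟨n, h1, h2⟩
    exact ⟨mem_of_smul_mem _ hG.exists_pi_inv n (subset_span h1),
      mem_of_smul_mem _ hG.exists_X_inv n (subset_span h2)⟩

lemma exists_eq_add_of_mem_span_top {A : Submodule P W} {B : Submodule U W}
    (hAB : span E (A : Set W) ≤ span E (B : Set W)) {x : W} (hx : x ∈ span E (A : Set W))
    (m : ℕ) : ∃ k : ℕ, ∃ y ∈ A, ∃ z ∈ span U ((A : Set W) ∩ B),
      X ^ k • x = y + π ^ m • z := by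
  have hXU : X ∈ U := hG.memU hG.X_mem
  have hXP : X ∈ P := hG.memP hG.X_mem
  induction hx using Submodule.span_induction generalizing m with
  | mem x hx => exact ⟨0, x, hx, 0, Submodule.zero_mem _, by simp⟩
  | zero => exact ⟨0, 0, A.zero_mem, 0, Submodule.zero_mem _, by simp⟩
  | add x x' _ _ hx hx' =>
    obtain ⟨k, y, hy, z, hz, h⟩ := hx m
    obtain ⟨k', y', hy', z', hz', h'⟩ := hx' m
    refine ⟨k + k', X ^ k' • y + X ^ k • y', ?_, X ^ k' • z + X ^ k • z', ?_, ?_⟩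
    · exact A.add_mem (smul_mem_of_mem _ (P.pow_mem hXP _) hy)
        (smul_mem_of_mem _ (P.pow_mem hXP _) hy')
    · exact Submodule.add_mem _ (smul_mem_of_mem _ (U.pow_mem hXU _) hz)
        (smul_mem_of_mem _ (U.pow_mem hXU _) hz')
    · have : X ^ (k + k') • (x + x') = X ^ k' • (X ^ k • x) + X ^ k • (X ^ k' • x') := by module
      rw [this, h, h']
      module
  | smul e x _ hx =>
    obtain ⟨n, hn⟩ := hG.exists_pow_mem e
    obtain ⟨k, y, hy, z, hz, h⟩ := hx (m + n)
    obtain ⟨p, hp⟩ := hG.exists_pow_smul_mem_span (hAB (subset_span hy))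
    rw [span_eq] at hp
    obtain ⟨g, hg, l, hl⟩ := hG.approx e (m + p)
    refine ⟨k + l, (X ^ l * (e - π ^ (m + p) * g)) • y, smul_mem_of_mem _ hl hy,
      (X ^ l * g) • (π ^ p • y) + (X ^ l * (π ^ n * e)) • z, Submodule.add_mem _ ?_ ?_, ?_⟩
    · exact smul_mem_of_mem _ (U.mul_mem (U.pow_mem hXU _) hg) (subset_span
        ⟨smul_mem_of_mem _ (P.pow_mem (hG.memP hG.pi_mem) p) hy, hp⟩)
    · exact smul_mem_of_mem _ (U.mul_mem (U.pow_mem hXU _) hn) hz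
    · have : X ^ (k + l) • (e • x) = (X ^ l * e) • (X ^ k • x) := by module
      rw [this, h]
      module

/-- `A ∩ B` generates `A` over `P` and `B` over `U`, whenever `A` and `B` generate the same
`E`-module. -/
lemma span_inter {A : Submodule P W} {B : Submodule U W}
    (hAB : span E (A : Set W) = span E (B : Set W)) :
    span P ((A : Set W) ∩ B) = A ∧ span U ((A : Set W) ∩ B) = B := by
  refine ⟨le_antisymm (span_le.2 Set.inter_subset_left) fun x hx => ?_,
    le_antisymm (span_le.2 Set.inter_subset_right) fun x hx => ?_⟩
  · obtain ⟨p, hp⟩ := hG.exists_pow_smul_mem_span (hAB.le (subset_span hx))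
    rw [span_eq] at hp
    exact mem_of_smul_mem _ hG.exists_pi_inv p
      (subset_span ⟨smul_mem_of_mem _ (P.pow_mem (hG.memP hG.pi_mem) p) hx, hp⟩)
  · obtain ⟨k, y, hy, z, hz, h⟩ := hG.exists_eq_add_of_mem_span_top hAB.le
      (hAB.ge (subset_span hx)) 0
    apply mem_of_smul_mem _ hG.exists_X_inv k
    rw [pow_zero, one_smul] at h
    have hzB : z ∈ B := (span_le.2 Set.inter_subset_right : _ ≤ B) hz
    have hyB : y ∈ B := by
      have : y = X ^ k • x - z := by rw [h]; abel
      rw [this]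
      exact B.sub_mem (smul_mem_of_mem _ (U.pow_mem (hG.memU hG.X_mem) k) hx) hzB
    rw [h]
    exact Submodule.add_mem _ (subset_span ⟨hy, hyB⟩) hz

end IsGluing

end Core

end Gluing
/-- `vK` is a complete discrete valuation, written additively. -/
class CompleteDVal (vK : K → WithTop ℤ) : Prop where
  eq_top_iff : ∀ x : K, vK x = ⊤ ↔ x = 0
  map_mul : ∀ x y : K, vK (x * y) = vK x + vK y
  map_add : ∀ x y : K, min (vK x) (vK y) ≤ vK (x + y)
  complete : ∀ x : ℕ → K,
      (∀ n : ℕ, ((n : ℤ) : WithTop ℤ) ≤ vK (x (n + 1) - x n)) →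
      ∃ l : K, ∀ n : ℕ, ((n : ℤ) : WithTop ℤ) ≤ vK (l - x n)

namespace Laurent

/-- The inequality `c ≤ vK a`, for a rational `c`. -/
def VGe (vK : K → WithTop ℤ) (a : K) (c : ℚ) : Prop := ∀ z : ℤ, vK a = z → c ≤ z

section Valuation

variable {vK : K → WithTop ℤ}

omit [Field K] in
lemma vge_iff {a : K} {c : ℚ} : VGe vK a c ↔ ((⌈c⌉ : ℤ) : WithTop ℤ) ≤ vK a := by
  unfold VGe
  rcases h : vK a with _ | z
  · exact ⟨fun _ => le_top, fun _ z hz => absurd hz (by exact WithTop.top_ne_coe)⟩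
  · constructor
    · intro h
      exact WithTop.coe_le_coe.2 (Int.ceil_le.2 (h z rfl))
    · intro h z' hz'
      have h1 : z = z' := WithTop.coe_injective hz'
      exact h1 ▸ Int.ceil_le.1 (WithTop.coe_le_coe.1 h)

omit [Field K] in
lemma vge_int_iff {a : K} {c : ℤ} : VGe vK a c ↔ (c : WithTop ℤ) ≤ vK a := by
  rw [vge_iff, Int.ceil_intCast]

omit [Field K] in
lemma VGe.mono {a : K} {c b : ℚ} (h : VGe vK a c) (hb : b ≤ c) : VGe vK a b :=
  fun z hz => hb.trans (h z hz)

variable [hv : CompleteDVal vK]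
include hv

lemma exists_val {a : K} (ha : a ≠ 0) : ∃ z : ℤ, vK a = z := by
  rcases h : vK a with _ | z
  · exact absurd ((hv.eq_top_iff a).1 h) ha
  · exact ⟨z, rfl⟩

lemma vge_zero (c : ℚ) : VGe vK (0 : K) c := by
  intro z hz
  rw [(hv.eq_top_iff 0).2 rfl] at hz
  exact absurd hz WithTop.top_ne_coe

lemma val_one : vK (1 : K) = (0 : ℤ) := by
  obtain ⟨z, hz⟩ := exists_val (vK := vK) (one_ne_zero (α := K))
  have h := hv.map_mul 1 1
  rw [mul_one, hz] at h
  have : z = z + z := by exact_mod_cast h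
  rw [hz]
  congr 1
  omega

lemma val_neg_one : vK (-1 : K) = (0 : ℤ) := by
  obtain ⟨z, hz⟩ := exists_val (vK := vK) (neg_ne_zero.2 (one_ne_zero (α := K)))
  have h := hv.map_mul (-1) (-1)
  rw [neg_one_mul, neg_neg, val_one (vK := vK), hz] at h
  have : (0 : ℤ) = z + z := by exact_mod_cast h
  rw [hz]
  congr 1
  omega

lemma VGe.add {a b : K} {c : ℚ} (ha : VGe vK a c) (hb : VGe vK b c) : VGe vK (a + b) c :=
  vge_iff.2 ((le_min (vge_iff.1 ha) (vge_iff.1 hb)).trans (hv.map_add a b))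

lemma VGe.mul {a b : K} {c e : ℚ} (ha : VGe vK a c) (hb : VGe vK b e) :
    VGe vK (a * b) (c + e) := by
  intro z hz
  by_cases ha0 : a = 0
  · rw [ha0, zero_mul] at hz
    exact vge_zero (vK := vK) _ z hz
  by_cases hb0 : b = 0
  · rw [hb0, mul_zero] at hz
    exact vge_zero (vK := vK) _ z hz
  obtain ⟨x, hx⟩ := exists_val (vK := vK) ha0
  obtain ⟨y, hy⟩ := exists_val (vK := vK) hb0
  rw [hv.map_mul, hx, hy] at hz
  have : x + y = z := by exact_mod_cast hz
  rw [← this]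
  push_cast
  exact add_le_add (ha x hx) (hb y hy)

lemma VGe.neg {a : K} {c : ℚ} (ha : VGe vK a c) : VGe vK (-a) c := by
  have h : VGe vK (-1 : K) 0 := by
    intro z hz
    rw [val_neg_one (vK := vK)] at hz
    have : (0 : ℤ) = z := by exact_mod_cast hz
    simp [← this]
  simpa using h.mul ha

lemma VGe.sub {a b : K} {c : ℚ} (ha : VGe vK a c) (hb : VGe vK b c) : VGe vK (a - b) c := by
  rw [sub_eq_add_neg]
  exact ha.add hb.neg

lemma vge_sum {ι : Type*} {s : Finset ι} {f : ι → K} {c : ℚ} (h : ∀ i ∈ s, VGe vK (f i) c) :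
    VGe vK (∑ i ∈ s, f i) c :=
  Finset.sum_induction _ (fun a => VGe vK a c) (fun _ _ => VGe.add) (vge_zero c) h

lemma eq_zero_of_vge {a : K} (h : ∀ c, VGe vK a c) : a = 0 := by
  by_contra ha
  obtain ⟨z, hz⟩ := exists_val (vK := vK) ha
  have := h (z + 1) z hz
  linarith

lemma val_zpow {a : K} (ha : vK a = (1 : ℤ)) (n : ℤ) : vK (a ^ n) = n := by
  have ha0 : a ≠ 0 := by
    rintro rfl
    rw [(hv.eq_top_iff 0).2 rfl] at ha
    exact absurd ha WithTop.top_ne_coe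
  induction n with
  | zero => simpa using val_one (vK := vK)
  | succ n ih => rw [zpow_add_one₀ ha0, hv.map_mul, ih, ha]; rfl
  | pred n ih =>
    have h := hv.map_mul (a ^ (-(n : ℤ) - 1)) a
    obtain ⟨z, hz⟩ := exists_val (vK := vK) (zpow_ne_zero (-(n : ℤ) - 1) ha0)
    rw [← zpow_add_one₀ ha0, sub_add_cancel, ih, ha, hz] at h
    have : -(n : ℤ) = z + 1 := by exact_mod_cast h
    rw [hz]
    congr 1
    omega

lemma val_inv {a : K} {z : ℤ} (h : vK a = z) : vK a⁻¹ = ((-z : ℤ) : WithTop ℤ) := by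
  have ha0 : a ≠ 0 := by
    rintro rfl
    rw [(hv.eq_top_iff 0).2 rfl] at h
    exact absurd h WithTop.top_ne_coe
  obtain ⟨y, hy⟩ := exists_val (vK := vK) (inv_ne_zero ha0)
  have h1 := hv.map_mul a a⁻¹
  rw [mul_inv_cancel₀ ha0, val_one (vK := vK), h, hy] at h1
  have : (0 : ℤ) = z + y := by exact_mod_cast h1
  rw [hy]
  congr 1
  omega

end Valuation

section Limits

/-- `l` is the limit of `s` for the valuation `vK`. -/
def IsLim (vK : K → WithTop ℤ) (s : ℕ → K) (l : K) : Prop :=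
  ∀ m : ℚ, ∃ N0 : ℕ, ∀ N ≥ N0, VGe vK (s N - l) m

variable {vK : K → WithTop ℤ} [hv : CompleteDVal vK]
include hv

lemma IsLim.vge {s : ℕ → K} {l : K} (h : IsLim vK s l) {c : ℚ} {N1 : ℕ}
    (hs : ∀ N ≥ N1, VGe vK (s N) c) : VGe vK l c := by
  obtain ⟨N0, hN0⟩ := h c
  have h1 := (hs (max N0 N1) (le_max_right _ _)).sub (hN0 (max N0 N1) (le_max_left _ _))
  simpa using h1

lemma IsLim.sub {s t : ℕ → K} {l l' : K} (h : IsLim vK s l) (h' : IsLim vK t l') :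
    IsLim vK (fun N => s N - t N) (l - l') := by
  intro m
  obtain ⟨N0, hN0⟩ := h m
  obtain ⟨N1, hN1⟩ := h' m
  refine ⟨max N0 N1, fun N hN => ?_⟩
  have := (hN0 N (le_of_max_le_left hN)).sub (hN1 N (le_of_max_le_right hN))
  convert this using 1
  ring

lemma IsLim.add {s t : ℕ → K} {l l' : K} (h : IsLim vK s l) (h' : IsLim vK t l') :
    IsLim vK (fun N => s N + t N) (l + l') := by
  intro m
  obtain ⟨N0, hN0⟩ := h m
  obtain ⟨N1, hN1⟩ := h' m
  refine ⟨max N0 N1, fun N hN => ?_⟩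
  have := (hN0 N (le_of_max_le_left hN)).add (hN1 N (le_of_max_le_right hN))
  convert this using 1
  ring

lemma isLim_of_eventually_eq {s : ℕ → K} {l : K} {N0 : ℕ} (h : ∀ N ≥ N0, s N = l) :
    IsLim vK s l :=
  fun m => ⟨N0, fun N hN => by rw [h N hN, sub_self]; exact vge_zero m⟩

lemma IsLim.unique {s : ℕ → K} {l l' : K} (h : IsLim vK s l) (h' : IsLim vK s l') : l = l' := by
  rw [← sub_eq_zero]
  refine eq_zero_of_vge (vK := vK) fun c => (h.sub h').vge (N1 := 0) fun N _ => ?_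
  rw [sub_self]
  exact vge_zero c

lemma exists_isLim {s : ℕ → K}
    (hs : ∀ m : ℚ, ∃ N0 : ℕ, ∀ N ≥ N0, VGe vK (s (N + 1) - s N) m) : ∃ l, IsLim vK s l := by
  choose φ hφ using fun m : ℕ => hs m
  have hdiff : ∀ m N N' : ℕ, φ m ≤ N → N ≤ N' → VGe vK (s N' - s N) m := by
    intro m N N' hN hNN'
    induction N', hNN' using Nat.le_induction with
    | base => rw [sub_self]; exact vge_zero _
    | succ n hn ih =>
      rw [← sub_add_sub_cancel _ (s n)]
      exact (hφ m n (hN.trans hn)).add ih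
  let ψ : ℕ → ℕ := fun n => ∑ k ∈ Finset.range (n + 1), φ k
  have hψ : ∀ n, φ n ≤ ψ n := fun n =>
    Finset.single_le_sum (f := φ) (fun _ _ => Nat.zero_le _) (Finset.self_mem_range_succ n)
  obtain ⟨l, hl⟩ := hv.complete (fun n => s (ψ n)) fun n => by
    rw [← vge_int_iff]
    refine hdiff n _ _ (hψ n) ?_
    simp only [ψ]
    rw [Finset.sum_range_succ _ (n + 1)]
    omega
  refine ⟨l, fun m => ?_⟩
  obtain ⟨n, hn⟩ := exists_nat_ge m
  refine ⟨ψ n, fun N hN => ?_⟩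
  have h1 := hdiff n (ψ n) N (hψ n) hN
  have h2 : VGe vK (l - s (ψ n)) n := by
    have := vge_int_iff.2 (hl n)
    exact_mod_cast this
  have := (h1.sub h2).mono hn
  simpa using this

lemma mulL_eq {f g : ℤ → K} {n : ℤ} {l : K} (h : IsLim vK (psum f g n) l) :
    mulL vK f g n = l := by
  have key : ∀ l : K, (∀ m : ℤ, ∃ N0 : ℕ, ∀ N : ℕ, N0 ≤ N →
      (m : WithTop ℤ) ≤ vK (psum f g n N - l)) ↔ IsLim vK (psum f g n) l := by
    intro l
    constructor
    · intro h m
      obtain ⟨N0, hN0⟩ := h ⌈m⌉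
      exact ⟨N0, fun N hN => vge_iff.2 (hN0 N hN)⟩
    · intro h m
      obtain ⟨N0, hN0⟩ := h m
      exact ⟨N0, fun N hN => vge_int_iff.1 (hN0 N hN)⟩
  unfold mulL
  have hex : ∃ l : K, ∀ m : ℤ, ∃ N0 : ℕ, ∀ N : ℕ, N0 ≤ N →
      (m : WithTop ℤ) ≤ vK (psum f g n N - l) := ⟨l, (key l).2 h⟩
  rw [dif_pos hex]
  exact ((key _).1 hex.choose_spec).unique h

omit hv in
lemma psum_single (a : K) (k : ℤ) (f : ℤ → K) (n : ℤ) {N : ℕ} (hN : k.natAbs ≤ N) :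
    psum (fun i => if i = k then a else 0) f n N = a * f (n - k) := by
  unfold psum
  rw [Finset.sum_eq_single k]
  · simp
  · intro b _ hb
    simp [hb]
  · intro hk
    exact absurd (Finset.mem_Icc.2 ⟨by omega, by omega⟩) hk

lemma mulL_single (a : K) (k : ℤ) (f : ℤ → K) (n : ℤ) :
    mulL vK (fun i => if i = k then a else 0) f n = a * f (n - k) :=
  mulL_eq (isLim_of_eventually_eq (N0 := k.natAbs) fun _ hN => psum_single a k f n hN)

lemma mulL_coeff (x y : HahnSeries ℤ K) : mulL vK x.coeff y.coeff = (x * y).coeff := by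
  funext n
  let A := Finset.antidiagonal x.isPWO_support y.isPWO_support n
  have hA : ∀ p ∈ A, p.2 = n - p.1 := fun p hp => by
    have := (Finset.mem_antidiagonal.1 hp).2.2
    omega
  refine mulL_eq (isLim_of_eventually_eq (N0 := ∑ p ∈ A, p.1.natAbs) fun N hN => ?_)
  have h1 : (x * y).coeff n = ∑ i ∈ A.image Prod.fst, x.coeff i * y.coeff (n - i) := by
    rw [HahnSeries.coeff_mul, Finset.sum_image]
    · exact Finset.sum_congr rfl fun p hp => by rw [hA p hp]
    · intro p hp q hq h
      exact Prod.ext h (by rw [hA p hp, hA q hq, h])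
  rw [h1]
  symm
  refine Finset.sum_subset ?_ ?_
  · intro i hi
    obtain ⟨p, hp, rfl⟩ := Finset.mem_image.1 hi
    have := (Finset.single_le_sum (f := fun p : ℤ × ℤ => p.1.natAbs)
      (fun _ _ => Nat.zero_le _) hp).trans hN
    simp only [Finset.mem_Icc] at this ⊢
    omega
  · intro i _ hi
    by_contra hne
    apply hi
    refine Finset.mem_image.2 ⟨(i, n - i), Finset.mem_antidiagonal.2 ⟨?_, ?_, ?_⟩, rfl⟩
    · exact left_ne_zero_of_mul hne
    · exact right_ne_zero_of_mul hne
    · simp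

end Limits

end Laurent

namespace Laurent

section Gauss

/-- The inequality `c ≤ v_ν f` for the Gauss valuation. -/
def GGe (vK : K → WithTop ℤ) (ν : ℚ) (f : ℤ → K) (c : ℚ) : Prop :=
  ∀ i : ℤ, VGe vK (f i) (c - ν * i)

/-- `v_K (f i) + ν i → +∞` as `i → -∞`. -/
def Tail (vK : K → WithTop ℤ) (ν : ℚ) (f : ℤ → K) : Prop :=
  ∀ m : ℚ, ∃ N : ℤ, ∀ i ≤ N, VGe vK (f i) (m - ν * i)

variable {vK : K → WithTop ℤ} {ν : ℚ}

omit [Field K] in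
lemma toE_le_iff (t : WithTop ℤ) (c b : ℚ) :
    ((c : ℝ) : EReal) ≤ toE t + ((b : ℝ) : EReal) ↔ ∀ z : ℤ, t = z → c - b ≤ z := by
  rcases t with _ | z
  · have h : toE (none : WithTop ℤ) = ⊤ := rfl
    rw [h, EReal.top_add_coe]
    exact ⟨fun _ z hz => absurd hz (by exact WithTop.top_ne_coe), fun _ => le_top⟩
  · have h : toE (some z : WithTop ℤ) = ((z : ℝ) : EReal) := rfl
    rw [h, ← EReal.coe_add, EReal.coe_le_coe_iff]
    constructor
    · intro h z' hz'
      have h1 : z = z' := WithTop.coe_injective hz'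
      rw [← h1]
      have : c ≤ (z : ℚ) + b := by exact_mod_cast h
      linarith
    · intro h
      have := h z rfl
      have : c ≤ (z : ℚ) + b := by linarith
      exact_mod_cast this

omit [Field K] in
lemma le_lterm_iff (f : ℤ → K) (c : ℚ) (i : ℤ) :
    ((c : ℝ) : EReal) ≤ lterm vK ν f i ↔ VGe vK (f i) (c - ν * i) :=
  toE_le_iff _ _ _

omit [Field K] in
lemma zero_le_lterm_iff (f : ℤ → K) (i : ℤ) :
    0 ≤ lterm vK ν f i ↔ VGe vK (f i) (0 - ν * i) := by
  rw [← le_lterm_iff]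
  simp

omit [Field K] in
lemma mem_ELSet_iff (f : ℤ → K) : f ∈ ELSet vK ν ↔ (∃ c, GGe vK ν f c) ∧ Tail vK ν f := by
  simp only [ELSet, Set.mem_ofPred_eq, le_lterm_iff]
  rfl

omit [Field K] in
lemma mem_SnuuLSet_iff (f : ℤ → K) : f ∈ SnuuLSet vK ν ↔ GGe vK ν f 0 ∧ Tail vK ν f := by
  simp only [SnuuLSet, Set.mem_ofPred_eq, le_lterm_iff, zero_le_lterm_iff]
  rfl

lemma mem_SnupiLSet_iff (f : ℤ → K) :
    f ∈ SnupiLSet vK ν ↔ (∀ i < 0, f i = 0) ∧ ∃ c, GGe vK ν f c := by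
  simp only [SnupiLSet, Set.mem_ofPred_eq, le_lterm_iff]
  rfl

lemma mem_SnuLSet_iff (f : ℤ → K) :
    f ∈ SnuLSet vK ν ↔ (∀ i < 0, f i = 0) ∧ GGe vK ν f 0 := by
  simp only [SnuLSet, Set.mem_ofPred_eq, zero_le_lterm_iff]
  rfl

omit [Field K] in
lemma GGe.mono {f : ℤ → K} {c b : ℚ} (h : GGe vK ν f c) (hb : b ≤ c) : GGe vK ν f b :=
  fun i => (h i).mono (by linarith)

variable [hv : CompleteDVal vK]
include hv

lemma tail_of_eq_zero {f : ℤ → K} {N : ℤ} (h : ∀ i < N, f i = 0) : Tail vK ν f :=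
  fun _ => ⟨N - 1, fun i hi => by rw [h i (by omega)]; exact vge_zero _⟩

lemma GGe.add {f g : ℤ → K} {c : ℚ} (hf : GGe vK ν f c) (hg : GGe vK ν g c) :
    GGe vK ν (f + g) c := fun i => (hf i).add (hg i)

lemma GGe.neg {f : ℤ → K} {c : ℚ} (hf : GGe vK ν f c) : GGe vK ν (-f) c := fun i => (hf i).neg

lemma GGe.sub {f g : ℤ → K} {c : ℚ} (hf : GGe vK ν f c) (hg : GGe vK ν g c) :
    GGe vK ν (f - g) c := fun i => (hf i).sub (hg i)

lemma Tail.add {f g : ℤ → K} (hf : Tail vK ν f) (hg : Tail vK ν g) : Tail vK ν (f + g) := by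
  intro m
  obtain ⟨N, hN⟩ := hf m
  obtain ⟨N', hN'⟩ := hg m
  exact ⟨min N N', fun i hi =>
    (hN i (hi.trans (min_le_left _ _))).add (hN' i (hi.trans (min_le_right _ _)))⟩

lemma ggE_zero (c : ℚ) : GGe vK ν (0 : ℤ → K) c := fun _ => vge_zero _

lemma eq_zero_of_ggE {f : ℤ → K} (h : ∀ c, GGe vK ν f c) : f = 0 := by
  funext i
  refine eq_zero_of_vge (vK := vK) fun c => ?_
  simpa using h (c + ν * i) i

lemma vge_mul_term {f g : ℤ → K} {c b : ℚ} {i j : ℤ} (hf : VGe vK (f i) (c - ν * i))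
    (hg : VGe vK (g j) (b - ν * j)) {n : ℤ} (hn : i + j = n) :
    VGe vK (f i * g j) (c + b - ν * n) := by
  refine (hf.mul hg).mono (le_of_eq ?_)
  rw [← hn]
  push_cast
  ring

lemma exists_isLim_psum {f g : ℤ → K} {c b : ℚ} (hf : GGe vK ν f c) (hft : Tail vK ν f)
    (hg : GGe vK ν g b) (hgt : Tail vK ν g) (n : ℤ) : ∃ l, IsLim vK (psum f g n) l := by
  apply exists_isLim
  intro m
  obtain ⟨N, hN⟩ := hft (m + ν * n - b)
  obtain ⟨N', hN'⟩ := hgt (m + ν * n - c)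
  refine ⟨N.natAbs + N'.natAbs + n.natAbs, fun L hL => ?_⟩
  have hI : Finset.Icc (-((L + 1 : ℕ) : ℤ)) ((L + 1 : ℕ) : ℤ) =
      insert ((L : ℤ) + 1) (insert (-((L : ℤ) + 1)) (Finset.Icc (-(L : ℤ)) L)) := by
    ext i
    simp only [Finset.mem_Icc, Finset.mem_insert]
    omega
  have h1 : psum f g n (L + 1) - psum f g n L =
      f (L + 1) * g (n - (L + 1)) + f (-(L + 1)) * g (n - -(L + 1)) := by
    unfold psum
    rw [hI, Finset.sum_insert, Finset.sum_insert]
    · ring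
    · simp only [Finset.mem_Icc]; omega
    · simp only [Finset.mem_Icc, Finset.mem_insert]; omega
  rw [h1]
  refine VGe.add ?_ ?_
  · refine (vge_mul_term (ν := ν) (n := n) (hf _) (hN' _ ?_) (by ring)).mono ?_
    · omega
    · apply le_of_eq; ring
  · refine (vge_mul_term (ν := ν) (n := n) (hN _ ?_) (hg _) (by ring)).mono ?_
    · omega
    · apply le_of_eq; ring

lemma vge_mulL {f g : ℤ → K} {c b : ℚ} (hf : GGe vK ν f c) (hft : Tail vK ν f)
    (hg : GGe vK ν g b) (hgt : Tail vK ν g) {n : ℤ} {e : ℚ}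
    (h : ∀ i, VGe vK (f i * g (n - i)) e) : VGe vK (mulL vK f g n) e := by
  obtain ⟨l, hl⟩ := exists_isLim_psum hf hft hg hgt n
  rw [mulL_eq hl]
  exact hl.vge (N1 := 0) fun N _ => vge_sum fun i _ => h i

lemma ggE_mulL {f g : ℤ → K} {c b : ℚ} (hf : GGe vK ν f c) (hft : Tail vK ν f)
    (hg : GGe vK ν g b) (hgt : Tail vK ν g) : GGe vK ν (mulL vK f g) (c + b) :=
  fun _ => vge_mulL hf hft hg hgt fun i => vge_mul_term (hf i) (hg _) (by ring)

lemma tail_mulL {f g : ℤ → K} {c b : ℚ} (hf : GGe vK ν f c) (hft : Tail vK ν f)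
    (hg : GGe vK ν g b) (hgt : Tail vK ν g) : Tail vK ν (mulL vK f g) := by
  intro m
  obtain ⟨N, hN⟩ := hft (m - b)
  obtain ⟨N', hN'⟩ := hgt (m - c)
  refine ⟨N + N', fun n hn => vge_mulL hf hft hg hgt fun i => ?_⟩
  rcases le_total i N with hi | hi
  · refine (vge_mul_term (ν := ν) (n := n) (hN i hi) (hg _) (by ring)).mono ?_
    apply le_of_eq; ring
  · refine (vge_mul_term (ν := ν) (n := n) (hf i) (hN' (n - i) (by omega)) (by ring)).mono ?_
    apply le_of_eq; ring

end Gauss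

/-- The additive group underlying `E`. -/
def addE (vK : K → WithTop ℤ) (ν : ℚ) [hv : CompleteDVal vK] : AddSubgroup (ℤ → K) where
  carrier := {f | (∃ c, GGe vK ν f c) ∧ Tail vK ν f}
  zero_mem' := ⟨⟨0, ggE_zero 0⟩, tail_of_eq_zero (N := 0) fun _ _ => rfl⟩
  add_mem' := by
    rintro f g ⟨⟨c, hc⟩, hf⟩ ⟨⟨b, hb⟩, hg⟩
    exact ⟨⟨min c b, (hc.mono (min_le_left _ _)).add (hb.mono (min_le_right _ _))⟩, hf.add hg⟩
  neg_mem' := by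
    rintro f ⟨⟨c, hc⟩, hf⟩
    refine ⟨⟨c, hc.neg⟩, fun m => ?_⟩
    obtain ⟨N, hN⟩ := hf m
    exact ⟨N, fun i hi => (hN i hi).neg⟩

/-- The ring `E`. -/
def LaurE (vK : K → WithTop ℤ) (ν : ℚ) [CompleteDVal vK] : Type := addE vK ν

namespace LaurE

variable {vK : K → WithTop ℤ} {ν : ℚ} [hv : CompleteDVal vK]

instance : AddCommGroup (LaurE vK ν) := inferInstanceAs (AddCommGroup (addE vK ν))

/-- The coefficients of an element of `E`. -/
def coeff : LaurE vK ν →+ (ℤ → K) := (addE vK ν).subtype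

lemma coeff_injective : Function.Injective (coeff : LaurE vK ν → ℤ → K) := Subtype.val_injective

lemma ext {f g : LaurE vK ν} (h : ∀ n, coeff f n = coeff g n) : f = g :=
  coeff_injective (funext h)

/-- The element of `E` with given coefficients. -/
def mk (f : ℤ → K) (c : ℚ) (h : GGe vK ν f c) (h' : Tail vK ν f) : LaurE vK ν :=
  ⟨f, ⟨c, h⟩, h'⟩

@[simp] lemma coeff_mk (f : ℤ → K) (c : ℚ) (h : GGe vK ν f c) (h' : Tail vK ν f) :
    coeff (mk f c h h') = f := rfl

lemma exists_ggE (f : LaurE vK ν) : ∃ c, GGe vK ν (coeff f) c := f.2.1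

lemma tail (f : LaurE vK ν) : Tail vK ν (coeff f) := f.2.2

lemma range_coeff : Set.range (coeff : LaurE vK ν → ℤ → K) = ELSet vK ν := by
  ext f
  rw [mem_ELSet_iff]
  exact ⟨fun ⟨g, hg⟩ => hg ▸ g.2, fun h => ⟨⟨f, h⟩, rfl⟩⟩

instance : Mul (LaurE vK ν) where
  mul f g := ⟨mulL vK (coeff f) (coeff g), by
    obtain ⟨c, hc⟩ := f.exists_ggE
    obtain ⟨b, hb⟩ := g.exists_ggE
    exact ⟨⟨c + b, ggE_mulL hc f.tail hb g.tail⟩, tail_mulL hc f.tail hb g.tail⟩⟩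

lemma coeff_mul (f g : LaurE vK ν) : coeff (f * g) = mulL vK (coeff f) (coeff g) := rfl

lemma isLim_coeff_mul (f g : LaurE vK ν) (n : ℤ) :
    IsLim vK (psum (coeff f) (coeff g) n) (coeff (f * g) n) := by
  obtain ⟨c, hc⟩ := f.exists_ggE
  obtain ⟨b, hb⟩ := g.exists_ggE
  obtain ⟨l, hl⟩ := exists_isLim_psum hc f.tail hb g.tail n
  rwa [coeff_mul, mulL_eq hl]

lemma ggE_mul {f g : LaurE vK ν} {c b : ℚ} (hf : GGe vK ν (coeff f) c)
    (hg : GGe vK ν (coeff g) b) : GGe vK ν (coeff (f * g)) (c + b) :=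
  ggE_mulL hf f.tail hg g.tail

lemma right_distrib' (f f' g : LaurE vK ν) : (f + f') * g = f * g + f' * g := by
  refine ext fun n => (isLim_coeff_mul _ _ n).unique (vK := vK) ?_
  rw [map_add, map_add, Pi.add_apply]
  convert! (isLim_coeff_mul f g n).add (isLim_coeff_mul f' g n) using 2 with N
  simp [psum, add_mul, Finset.sum_add_distrib]

lemma left_distrib' (f g g' : LaurE vK ν) : f * (g + g') = f * g + f * g' := by
  refine ext fun n => (isLim_coeff_mul _ _ n).unique (vK := vK) ?_
  rw [map_add, map_add, Pi.add_apply]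
  convert! (isLim_coeff_mul f g n).add (isLim_coeff_mul f g' n) using 2 with N
  simp [psum, mul_add, Finset.sum_add_distrib]

/-- The elements of `E` whose support is bounded below. -/
def IsLow (f : LaurE vK ν) : Prop := ∃ x : HahnSeries ℤ K, coeff f = x.coeff

lemma isLow_of_eq_zero {f : LaurE vK ν} {N : ℤ} (h : ∀ i < N, coeff f i = 0) : IsLow f :=
  ⟨HahnSeries.ofSuppBddBelow (coeff f) ⟨N, fun i hi => not_lt.1 fun hlt => hi (h i hlt)⟩, rfl⟩

lemma IsLow.mul {f g : LaurE vK ν} (hf : IsLow f) (hg : IsLow g) : IsLow (f * g) := by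
  obtain ⟨x, hx⟩ := hf
  obtain ⟨y, hy⟩ := hg
  exact ⟨x * y, by rw [coeff_mul, hx, hy, mulL_coeff]⟩

/-- The part of a Laurent series supported in a set of exponents. -/
def part (s : Set ℤ) [DecidablePred (· ∈ s)] : LaurE vK ν →+ LaurE vK ν where
  toFun f := ⟨fun i => if i ∈ s then coeff f i else 0, by
    obtain ⟨c, hc⟩ := f.exists_ggE
    refine ⟨⟨c, fun i => ?_⟩, fun m => ?_⟩
    · dsimp only
      split_ifs
      exacts [hc i, vge_zero _]
    · obtain ⟨N, hN⟩ := f.tail m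
      refine ⟨N, fun i hi => ?_⟩
      dsimp only
      split_ifs
      exacts [hN i hi, vge_zero _]⟩
  map_zero' := ext fun i => by
    change (if i ∈ s then (0 : K) else 0) = 0
    simp
  map_add' f g := ext fun i => by
    change (if i ∈ s then (coeff f i + coeff g i : K) else 0) =
      (if i ∈ s then coeff f i else 0) + (if i ∈ s then coeff g i else 0)
    split_ifs <;> simp

lemma coeff_part (s : Set ℤ) [DecidablePred (· ∈ s)] (f : LaurE vK ν) (i : ℤ) :
    coeff (part s f) i = if i ∈ s then coeff f i else 0 := rfl

lemma ggE_part {s : Set ℤ} [DecidablePred (· ∈ s)] {f : LaurE vK ν} {c : ℚ}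
    (h : ∀ i ∈ s, VGe vK (coeff f i) (c - ν * i)) : GGe vK ν (coeff (part s f)) c := by
  intro i
  rw [coeff_part]
  split_ifs with hi
  exacts [h i hi, vge_zero _]

lemma exists_part_Iic_ggE (f : LaurE vK ν) (m : ℚ) :
    ∃ N : ℤ, GGe vK ν (coeff (part (Set.Iic N) f)) m := by
  obtain ⟨N, hN⟩ := f.tail m
  exact ⟨N, ggE_part hN⟩

lemma part_Iic_add_part_Ioi (N : ℤ) (f : LaurE vK ν) :
    part (Set.Iic N) f + part (Set.Ioi N) f = f := by
  refine ext fun i => ?_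
  rw [map_add, Pi.add_apply, coeff_part, coeff_part]
  by_cases h : i ≤ N
  · simp [h]
  · simp [h, not_le.1 h]

lemma isLow_part_Ioi (N : ℤ) (f : LaurE vK ν) : IsLow (part (Set.Ioi N) f) :=
  isLow_of_eq_zero (N := N) fun i hi => by
    rw [coeff_part, if_neg]
    simpa using hi.le

/-- A bounded additive map vanishing on series with support bounded below is zero. -/
lemma eq_zero_of_isLow {φ : LaurE vK ν → LaurE vK ν} (hadd : ∀ f g, φ (f + g) = φ f + φ g)
    {c : ℚ} (hb : ∀ f b, GGe vK ν (coeff f) b → GGe vK ν (coeff (φ f)) (b + c))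
    (hlow : ∀ f, IsLow f → φ f = 0) (f : LaurE vK ν) : φ f = 0 := by
  apply coeff_injective
  rw [map_zero]
  refine eq_zero_of_ggE (vK := vK) (ν := ν) fun m => ?_
  obtain ⟨N, hN⟩ := f.exists_part_Iic_ggE (m - c)
  have h := hb _ _ hN
  rw [← part_Iic_add_part_Ioi N f, hadd, hlow _ (isLow_part_Ioi N f), add_zero]
  simpa using h

lemma mul_comm' (f g : LaurE vK ν) : f * g = g * f := by
  rw [← sub_eq_zero]
  revert f g
  suffices H : ∀ f g : LaurE vK ν, IsLow f → f * g - g * f = 0 by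
    intro f g
    obtain ⟨cg, hg⟩ := g.exists_ggE
    refine eq_zero_of_isLow (φ := fun f => f * g - g * f) (c := cg) (fun f f' => ?_)
      (fun f b hb => ?_) (fun f hf => H f g hf) f
    · simp only [right_distrib', left_distrib']; abel
    · rw [map_sub]
      exact (ggE_mul hb hg).sub (by rw [add_comm]; exact ggE_mul hg hb)
  intro f g hlow
  obtain ⟨cf, hf⟩ := f.exists_ggE
  refine eq_zero_of_isLow (φ := fun g => f * g - g * f) (c := cf) (fun f f' => ?_)
      (fun g b hb => ?_) (fun g hg => ?_) g
  · simp only [right_distrib', left_distrib']; abel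
  · rw [map_sub]
    exact (by rw [add_comm]; exact ggE_mul hf hb : GGe vK ν _ _).sub (ggE_mul hb hf)
  · obtain ⟨x, hx⟩ := hlow
    obtain ⟨y, hy⟩ := hg
    apply coeff_injective
    rw [map_sub, map_zero, coeff_mul, coeff_mul, hx, hy, mulL_coeff, mulL_coeff, mul_comm, sub_self]

lemma mul_assoc' (f g h : LaurE vK ν) : f * g * h = f * (g * h) := by
  rw [← sub_eq_zero]
  obtain ⟨cf, hf⟩ := f.exists_ggE
  obtain ⟨cg, hg⟩ := g.exists_ggE
  obtain ⟨ch, hh⟩ := h.exists_ggE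
  refine eq_zero_of_isLow (φ := fun f => f * g * h - f * (g * h)) (c := cg + ch)
    (fun f f' => ?_) (fun f b hb => ?_) (fun f hlf => ?_) f
  · simp only [right_distrib']; abel
  · rw [map_sub]
    refine GGe.sub ?_ (ggE_mul hb (ggE_mul hg hh))
    rw [← add_assoc]
    exact ggE_mul (ggE_mul hb hg) hh
  obtain ⟨cf, hf⟩ := f.exists_ggE
  refine eq_zero_of_isLow (φ := fun g => f * g * h - f * (g * h)) (c := cf + ch)
    (fun f f' => ?_) (fun g b hb => ?_) (fun g hlg => ?_) g
  · simp only [right_distrib', left_distrib']; abel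
  · rw [map_sub]
    have e : b + (cf + ch) = cf + b + ch := by ring
    refine GGe.sub ?_ ?_
    · rw [e]
      exact ggE_mul (ggE_mul hf hb) hh
    · rw [e, add_assoc]
      exact ggE_mul hf (ggE_mul hb hh)
  obtain ⟨cg, hg⟩ := g.exists_ggE
  refine eq_zero_of_isLow (φ := fun h => f * g * h - f * (g * h)) (c := cf + cg)
    (fun f f' => ?_) (fun h b hb => ?_) (fun h hlh => ?_) h
  · simp only [left_distrib']; abel
  · rw [map_sub, add_comm b]
    refine GGe.sub (ggE_mul (ggE_mul hf hg) hb) ?_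
    rw [add_assoc]
    exact ggE_mul hf (ggE_mul hg hb)
  obtain ⟨x, hx⟩ := hlf
  obtain ⟨y, hy⟩ := hlg
  obtain ⟨z, hz⟩ := hlh
  apply coeff_injective
  rw [map_sub, map_zero, coeff_mul, coeff_mul, coeff_mul, coeff_mul, hx, hy, hz, mulL_coeff,
    mulL_coeff, mulL_coeff, mulL_coeff, mul_assoc, sub_self]

/-- The monomial `a u^k`. -/
def mono (a : K) (k : ℤ) : LaurE vK ν := ⟨fun i => if i = k then a else 0, by
  by_cases ha : a = 0
  · subst ha
    simp only [ite_self]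
    exact (addE vK ν).zero_mem
  obtain ⟨z, hz⟩ := exists_val (vK := vK) ha
  refine ⟨⟨z + ν * k, fun i => ?_⟩, tail_of_eq_zero (N := k) fun i hi => if_neg hi.ne⟩
  dsimp only
  split_ifs with h
  · subst h
    intro z' hz'
    rw [hz] at hz'
    have : z = z' := by exact_mod_cast hz'
    rw [← this]
    linarith
  · exact vge_zero _⟩

lemma coeff_mono (a : K) (k : ℤ) :
    coeff (mono a k : LaurE vK ν) = fun i => if i = k then a else 0 := rfl

lemma ggE_mono {a : K} {c : ℚ} (h : VGe vK a c) (k : ℤ) :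
    GGe vK ν (coeff (mono a k : LaurE vK ν)) (c + ν * k) := by
  intro i
  rw [coeff_mono]
  dsimp only
  split_ifs with hi
  · subst hi
    simpa using h
  · exact vge_zero _

lemma coeff_mono_mul (a : K) (k : ℤ) (f : LaurE vK ν) (n : ℤ) :
    coeff (mono a k * f) n = a * coeff f (n - k) := by
  rw [coeff_mul, coeff_mono, mulL_single]

instance : One (LaurE vK ν) := ⟨mono 1 0⟩

lemma one_def : (1 : LaurE vK ν) = mono 1 0 := rfl

lemma one_mul' (f : LaurE vK ν) : 1 * f = f :=
  ext fun n => by rw [one_def, coeff_mono_mul, one_mul, sub_zero]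

instance : CommRing (LaurE vK ν) :=
  { (inferInstance : AddCommGroup (LaurE vK ν)),
    (inferInstance : Mul (LaurE vK ν)),
    (inferInstance : One (LaurE vK ν)) with
    left_distrib := left_distrib'
    right_distrib := right_distrib'
    zero_mul := fun f => by
      have := right_distrib' 0 0 f
      simpa using this
    mul_zero := fun f => by
      have := left_distrib' f 0 0
      simpa using this
    mul_assoc := mul_assoc'
    one_mul := one_mul'
    mul_one := fun f => by rw [mul_comm', one_mul']
    mul_comm := mul_comm' }

lemma mono_mul_mono (a b : K) (k l : ℤ) :
    (mono a k * mono b l : LaurE vK ν) = mono (a * b) (k + l) :=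
  ext fun n => by
    rw [coeff_mono_mul, coeff_mono, coeff_mono]
    simp only [sub_eq_iff_eq_add, add_comm l k]
    split_ifs <;> simp

end LaurE

end Laurent

namespace Laurent.LaurE

variable {vK : K → WithTop ℤ} {ν : ℚ} [hv : CompleteDVal vK]

section Subrings

lemma coeff_mul_eq_zero {f g : LaurE vK ν} {n : ℤ}
    (h : ∀ i, coeff f i = 0 ∨ coeff g (n - i) = 0) : coeff (f * g) n = 0 :=
  (isLim_coeff_mul f g n).unique (vK := vK) <| isLim_of_eventually_eq (N0 := 0) fun _ _ =>
    Finset.sum_eq_zero fun i _ => mul_eq_zero.2 (h i)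

lemma coeff_one (n : ℤ) : coeff (1 : LaurE vK ν) n = if n = 0 then 1 else 0 := rfl

lemma ggE_one : GGe vK ν (coeff (1 : LaurE vK ν)) 0 := by
  have h : VGe vK (1 : K) 0 := fun z hz => by
    rw [val_one (vK := vK)] at hz
    have : (0 : ℤ) = z := by exact_mod_cast hz
    simp [← this]
  simpa [one_def] using ggE_mono (ν := ν) h 0

/-- The ring `S_{ν,π}`. -/
def SP (vK : K → WithTop ℤ) (ν : ℚ) [CompleteDVal vK] : Subring (LaurE vK ν) where
  carrier := {f | ∀ i < 0, coeff f i = 0}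
  zero_mem' := fun i _ => by simp
  one_mem' := fun i hi => by rw [coeff_one, if_neg hi.ne]
  add_mem' := fun {f g} hf hg i hi => by simp [hf i hi, hg i hi]
  neg_mem' := fun {f} hf i hi => by simp [hf i hi]
  mul_mem' := fun {f g} hf hg n hn => coeff_mul_eq_zero fun i => by
    rcases lt_or_ge i 0 with hi | hi
    · exact .inl (hf i hi)
    · exact .inr (hg _ (by omega))

/-- The ring `S_{ν,u}`. -/
def SU (vK : K → WithTop ℤ) (ν : ℚ) [CompleteDVal vK] : Subring (LaurE vK ν) where
  carrier := {f | GGe vK ν (coeff f) 0}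
  zero_mem' := by
    rw [Set.mem_ofPred_eq, map_zero]
    exact ggE_zero 0
  one_mem' := ggE_one
  add_mem' := fun {f g} hf hg => by
    rw [Set.mem_ofPred_eq, map_add]
    exact hf.add hg
  neg_mem' := fun {f} hf => by
    rw [Set.mem_ofPred_eq, map_neg]
    exact hf.neg
  mul_mem' := fun {f g} hf hg => by
    have := ggE_mul hf hg
    rwa [add_zero] at this

/-- The ring `S_ν`. -/
def SS (vK : K → WithTop ℤ) (ν : ℚ) [CompleteDVal vK] : Subring (LaurE vK ν) := SP vK ν ⊓ SU vK ν

lemma mem_SS {f : LaurE vK ν} : f ∈ SS vK ν ↔ f ∈ SP vK ν ∧ f ∈ SU vK ν := Iff.rfl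

lemma image_coeff_SS : coeff '' (SS vK ν : Set (LaurE vK ν)) = SnuLSet vK ν := by
  ext f
  rw [mem_SnuLSet_iff]
  constructor
  · rintro ⟨g, ⟨h1, h2⟩, rfl⟩
    exact ⟨h1, h2⟩
  · rintro ⟨h1, h2⟩
    exact ⟨mk f 0 h2 (tail_of_eq_zero h1), ⟨h1, h2⟩, rfl⟩

lemma image_coeff_SP : coeff '' (SP vK ν : Set (LaurE vK ν)) = SnupiLSet vK ν := by
  ext f
  rw [mem_SnupiLSet_iff]
  constructor
  · rintro ⟨g, h, rfl⟩
    exact ⟨h, g.exists_ggE⟩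
  · rintro ⟨h1, c, h2⟩
    exact ⟨mk f c h2 (tail_of_eq_zero h1), h1, rfl⟩

lemma image_coeff_SU : coeff '' (SU vK ν : Set (LaurE vK ν)) = SnuuLSet vK ν := by
  ext f
  rw [mem_SnuuLSet_iff]
  constructor
  · rintro ⟨g, h, rfl⟩
    exact ⟨h, g.tail⟩
  · rintro ⟨h1, h2⟩
    exact ⟨mk f 0 h1 h2, h1, rfl⟩

end Subrings

section Contraction

lemma exists_limit {s : ℕ → LaurE vK ν} {c δ : ℚ} (hδ : 0 < δ)
    (hs : ∀ k : ℕ, GGe vK ν (coeff (s (k + 1) - s k)) (c + k * δ)) :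
    ∃ z : LaurE vK ν, ∀ k : ℕ, GGe vK ν (coeff (z - s k)) (c + k * δ) := by
  have hdiff : ∀ k N : ℕ, k ≤ N → GGe vK ν (coeff (s N) - coeff (s k)) (c + k * δ) := by
    intro k N hkN
    induction N, hkN using Nat.le_induction with
    | base => rw [sub_self]; exact ggE_zero _
    | succ N hN ih =>
      have h := (hs N).mono (b := c + k * δ) (by
        have : (k : ℚ) ≤ N := by exact_mod_cast hN
        nlinarith)
      rw [map_sub] at h
      simpa using h.add ih
  have hlim : ∀ i, ∃ l, IsLim vK (fun N => coeff (s N) i) l := by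
    intro i
    apply exists_isLim
    intro m
    obtain ⟨N0, hN0⟩ := exists_nat_ge ((m - c + ν * i) / δ)
    refine ⟨N0, fun N hN => ?_⟩
    have h := hs N i
    rw [map_sub, Pi.sub_apply] at h
    refine h.mono ?_
    have h1 : (N0 : ℚ) ≤ N := by exact_mod_cast hN
    have h2 := (div_le_iff₀ hδ).1 (hN0.trans h1)
    linarith
  choose z hz using hlim
  have hzs : ∀ k : ℕ, GGe vK ν (z - coeff (s k)) (c + k * δ) := by
    intro k i
    refine ((hz i).sub (isLim_of_eventually_eq (s := fun _ => coeff (s k) i) (N0 := 0)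
      fun _ _ => rfl)).vge (N1 := k) fun N hN => hdiff k N hN i
  obtain ⟨b, hb⟩ := (s 0).exists_ggE
  have hzb : GGe vK ν z (min (c + (0 : ℕ) * δ) b) := by
    have := ((hzs 0).mono (min_le_left _ _)).add (hb.mono (min_le_right _ b))
    simpa using this
  have hzt : Tail vK ν z := by
    intro m
    obtain ⟨k, hk⟩ := exists_nat_ge ((m - c) / δ)
    obtain ⟨N, hN⟩ := (s k).tail m
    refine ⟨N, fun i hi => ?_⟩
    have h1 := (div_le_iff₀ hδ).1 hk
    have := ((hzs k).mono (b := m) (by linarith) i).add (hN i hi)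
    simpa using this
  exact ⟨mk z _ hzb hzt, fun k => by rw [map_sub, coeff_mk]; exact hzs k⟩

/-- A contraction `T` of `E` makes `1 + T` surjective. -/
lemma exists_add_eq (T : LaurE vK ν →+ LaurE vK ν) {δ : ℚ} (hδ : 0 < δ)
    (hT : ∀ f c, GGe vK ν (coeff f) c → GGe vK ν (coeff (T f)) (c + δ))
    {J : Set ℤ} (hTJ : ∀ f, (∀ i ∈ J, coeff f i = 0) → ∀ i ∈ J, coeff (T f) i = 0)
    {g : LaurE vK ν} {c : ℚ} (hg : GGe vK ν (coeff g) c) (hgJ : ∀ i ∈ J, coeff g i = 0) :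
    ∃ z, z + T z = g ∧ GGe vK ν (coeff z) c ∧ ∀ i ∈ J, coeff z i = 0 := by
  let s : ℕ → LaurE vK ν := fun k => Nat.rec 0 (fun _ x => g - T x) k
  have hs : ∀ k, s (k + 1) = g - T (s k) := fun k => rfl
  have hs0 : s 0 = 0 := rfl
  have hstep : ∀ k : ℕ, GGe vK ν (coeff (s (k + 1) - s k)) (c + k * δ) := by
    intro k
    induction k with
    | zero => simpa [hs, hs0] using hg
    | succ k ih =>
      have h : s (k + 1 + 1) - s (k + 1) = - T (s (k + 1) - s k) := by
        rw [map_sub]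
        change (g - T (s (k + 1))) - (g - T (s k)) = _
        abel
      rw [h, map_neg]
      refine (hT _ _ ih).neg.mono ?_
      push_cast
      linarith
  obtain ⟨z, hz⟩ := exists_limit hδ hstep
  refine ⟨z, ?_, ?_, ?_⟩
  · rw [← sub_eq_zero]
    apply coeff_injective
    rw [map_zero]
    refine eq_zero_of_ggE (vK := vK) (ν := ν) fun m => ?_
    obtain ⟨k, hk⟩ := exists_nat_ge ((m - c) / δ)
    have h1 := (div_le_iff₀ hδ).1 hk
    have h : z + T z - g = (z - s (k + 1)) + T (z - s k) := by
      rw [hs k, map_sub]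
      abel
    rw [h, map_add]
    refine ((hz (k + 1)).mono ?_).add ((hT _ _ (hz k)).mono ?_)
    · push_cast; linarith
    · linarith
  · simpa [hs0] using hz 0
  · have hsJ : ∀ k, ∀ i ∈ J, coeff (s k) i = 0 := by
      intro k
      induction k with
      | zero => intro i _; simp [hs0]
      | succ k ih =>
        intro i hi
        rw [hs, map_sub, Pi.sub_apply, hgJ i hi, hTJ _ ih i hi, sub_zero]
    intro i hi
    refine eq_zero_of_vge (vK := vK) fun m => ?_
    obtain ⟨k, hk⟩ := exists_nat_ge ((m - c + ν * i) / δ)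
    have h1 := (div_le_iff₀ hδ).1 hk
    have := hz k i
    rw [map_sub, Pi.sub_apply, hsJ k i hi, sub_zero] at this
    exact this.mono (by linarith)

end Contraction

end Laurent.LaurE

namespace Laurent.LaurE

variable {vK : K → WithTop ℤ} {ν : ℚ} [hv : CompleteDVal vK]

section Division

omit [Field K] hv in
lemma vge_val {a : K} {z : ℤ} (h : vK a = z) : VGe vK a z := fun z' hz' => by
  rw [h] at hz'
  have : z = z' := by exact_mod_cast hz'
  rw [this]

/-- `coeff f i₀ u^i₀` is the leftmost term of `f` of minimal Gauss valuation, and the terms on its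
left have a valuation which is larger by at least `δ`. -/
def IsLead (f : LaurE vK ν) (δ : ℚ) (z i₀ : ℤ) : Prop :=
  vK (coeff f i₀) = z ∧ GGe vK ν (coeff f) (z + ν * i₀) ∧
    ∀ i < i₀, VGe vK (coeff f i) (z + ν * i₀ + δ - ν * i)

lemma exists_isLead {α : ℕ} {β : ℤ} (hα : 0 < α) (hν : ν = (β : ℚ) / (α : ℚ)) {f : LaurE vK ν}
    (hf : f ≠ 0) : ∃ z i₀, IsLead f (1 / α) z i₀ := by
  have hα' : (0 : ℚ) < α := by exact_mod_cast hα
  have hαν : α * ν = β := by rw [hν]; field_simp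
  have key : ∀ (x y w : ℤ) (e : ℚ), (w : ℚ) / α + e - ν * x ≤ y ↔ w + α * e ≤ α * y + β * x := by
    intro x y w e
    rw [← hαν, ← mul_le_mul_iff_right₀ hα', mul_sub, mul_add, mul_div_cancel₀ _ hα'.ne',
      sub_le_iff_le_add, mul_assoc]
  obtain ⟨c, hc⟩ := f.exists_ggE
  obtain ⟨m, ⟨i, z, hz, hm⟩, hmin⟩ := Int.exists_least_of_bdd
    (P := fun w => ∃ i z : ℤ, vK (coeff f i) = z ∧ α * z + β * i = w)
    ⟨⌊α * c⌋, by
      rintro w ⟨i, z, hz, rfl⟩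
      have h1 := hc i z hz
      refine Int.floor_le_iff.2 ?_
      have h2 : α * (c - ν * i) ≤ α * z := by gcongr
      rw [mul_sub, ← mul_assoc, hαν] at h2
      push_cast
      linarith⟩
    (by
      have : ∃ i, coeff f i ≠ 0 := by
        by_contra! h
        exact hf (ext fun n => by simp [h n])
      obtain ⟨i, hi⟩ := this
      obtain ⟨z, hz⟩ := exists_val (vK := vK) hi
      exact ⟨_, i, z, hz, rfl⟩)
  obtain ⟨i₀, ⟨z₀, hz₀, hm₀⟩, hmin₀⟩ := Int.exists_least_of_bdd
    (P := fun i => ∃ z : ℤ, vK (coeff f i) = z ∧ α * z + β * i = m)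
    (by
      obtain ⟨N, hN⟩ := f.tail (m / α + 1)
      refine ⟨N, ?_⟩
      rintro i ⟨z, hz, hm⟩
      by_contra! hi
      have h1 := (key _ _ _ _).1 (hN i hi.le z hz)
      have h2 : (α * z + β * i : ℚ) = m := by exact_mod_cast hm
      rw [h2] at h1
      linarith)
    ⟨i, z, hz, hm⟩
  have hz₀m : (z₀ : ℚ) + ν * i₀ = m / α := by
    rw [eq_div_iff hα'.ne', ← hm₀]
    push_cast
    rw [← hαν]
    ring
  refine ⟨z₀, i₀, hz₀, fun i z hz => ?_, fun i hi z hz => ?_⟩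
  · have := (key i z m 0).2 (by
      rw [mul_zero, add_zero]
      exact_mod_cast hmin _ ⟨i, z, hz, rfl⟩)
    rwa [add_zero, ← hz₀m] at this
  · have := (key i z m (1 / α)).2 (by
      rw [mul_one_div_cancel hα'.ne']
      have h1 := hmin _ ⟨i, z, hz, rfl⟩
      have h2 : m ≠ α * z + β * i := fun h => by
        have := hmin₀ i ⟨z, hz, h.symm⟩
        omega
      have h3 : m + 1 ≤ α * z + β * i := by omega
      exact_mod_cast h3)
    rwa [← hz₀m] at this

/-- A power series with constant term `1` and nonnegative Gauss valuation is invertible. -/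
lemma exists_inv_of_powerSeries {H : LaurE vK ν} (hP : H ∈ SP vK ν) (hU : H ∈ SU vK ν)
    (h0 : coeff H 0 = 1) : ∃ V ∈ SP vK ν, V ∈ SU vK ν ∧ H * V = 1 := by
  let P : PowerSeries K := PowerSeries.mk fun n => coeff H n
  have hP0 : PowerSeries.constantCoeff P = 1 := by
    rw [← PowerSeries.coeff_zero_eq_constantCoeff_apply, PowerSeries.coeff_mk]
    exact h0
  have hcoe : ∀ (Q : PowerSeries K) (i : ℤ), (HahnSeries.ofPowerSeries ℤ K Q).coeff i =
      if i < 0 then 0 else PowerSeries.coeff i.natAbs Q := fun Q i =>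
        PowerSeries.coeff_coe (f := Q) i
  have hH : coeff H = (HahnSeries.ofPowerSeries ℤ K P).coeff := by
    funext i
    rw [hcoe]
    split_ifs with hi
    · exact hP i hi
    · rw [PowerSeries.coeff_mk, Int.natAbs_of_nonneg (not_lt.1 hi)]
  have hinv : ∀ n : ℕ, VGe vK (PowerSeries.coeff n P⁻¹) (0 - ν * n) := by
    intro n
    induction n using Nat.strong_induction_on with
    | _ n ih =>
      rw [PowerSeries.coeff_inv, hP0, inv_one]
      split_ifs with hn
      · subst hn
        have := ggE_one (vK := vK) (ν := ν) 0
        simpa [coeff_one] using this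
      · rw [neg_one_mul]
        refine (vge_sum fun x hx => ?_).neg
        split_ifs with hxn
        · rw [PowerSeries.coeff_mk]
          have hx' : ((x.1 : ℤ) : ℚ) + x.2 = n := by
            have := Finset.HasAntidiagonal.mem_antidiagonal.1 hx
            exact_mod_cast this
          refine ((hU x.1).mul (ih x.2 hxn)).mono (le_of_eq ?_)
          rw [← hx']
          ring
        · exact vge_zero _
  have hV0 : ∀ i < 0, (HahnSeries.ofPowerSeries ℤ K P⁻¹).coeff i = 0 := fun i hi => by
    rw [hcoe, if_pos hi]
  have hVU : GGe vK ν (HahnSeries.ofPowerSeries ℤ K P⁻¹).coeff 0 := by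
    intro i
    rw [hcoe]
    split_ifs with hi
    · exact vge_zero _
    · have hi' : ((i.natAbs : ℕ) : ℚ) = (i : ℚ) := by
        rw [← Int.cast_natCast, Int.natAbs_of_nonneg (not_lt.1 hi)]
      rw [← hi']
      exact hinv _
  refine ⟨mk _ 0 hVU (tail_of_eq_zero hV0), hV0, hVU, coeff_injective ?_⟩
  rw [coeff_mul, coeff_mk, hH, mulL_coeff, ← map_mul, PowerSeries.mul_inv_cancel _ (by simp [hP0]),
    map_one]
  funext n
  rw [coeff_one, HahnSeries.coeff_one]
  split_ifs <;> rfl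

lemma part_Ici_add_part_Iio (N : ℤ) (f : LaurE vK ν) :
    part (Set.Ici N) f + part (Set.Iio N) f = f := by
  refine ext fun i => ?_
  rw [map_add, Pi.add_apply, coeff_part, coeff_part]
  by_cases h : N ≤ i
  · simp [h]
  · simp [h, not_le.1 h]

lemma IsLead.ne_zero {f : LaurE vK ν} {δ : ℚ} {z i₀ : ℤ} (h : IsLead f δ z i₀) :
    coeff f i₀ ≠ 0 := by
  intro h0
  have h1 := h.1
  rw [h0, (hv.eq_top_iff 0).2 rfl] at h1
  exact WithTop.top_ne_coe h1

lemma IsLead.exists_inv_part {f : LaurE vK ν} {δ : ℚ} {z i₀ : ℤ} (h : IsLead f δ z i₀) :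
    ∃ V ∈ SP vK ν, V ∈ SU vK ν ∧
      mono (coeff f i₀)⁻¹ (-i₀) * part (Set.Ici i₀) f * V = 1 := by
  refine exists_inv_of_powerSeries (fun i hi => ?_) ?_ ?_
  · rw [coeff_mono_mul, coeff_part, if_neg (by simpa using hi), mul_zero]
  · have := ggE_mul (ggE_mono (ν := ν) (vge_val (val_inv (vK := vK) h.1)) (-i₀))
      (ggE_part (s := Set.Ici i₀) fun i _ => h.2.1 i)
    refine this.mono (le_of_eq ?_)
    push_cast
    ring
  · rw [coeff_mono_mul, coeff_part]
    simp [h.ne_zero]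

lemma IsLead.exists_inv {f : LaurE vK ν} {δ : ℚ} {z i₀ : ℤ} (hδ : 0 < δ) (h : IsLead f δ z i₀) :
    ∃ g, f * g = 1 ∧ GGe vK ν (coeff g) (-(z + ν * i₀)) := by
  obtain ⟨V, -, hV, hVinv⟩ := h.exists_inv_part
  have hm := ggE_mono (ν := ν) (vge_val (val_inv (vK := vK) h.1)) (-i₀)
  obtain ⟨y, hy, hy0, -⟩ := exists_add_eq (δ := δ) (J := ∅) (c := 0) (g := 1)
    (AddMonoidHom.mulLeft (mono (coeff f i₀)⁻¹ (-i₀) * part (Set.Iio i₀) f * V)) hδ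
    (fun g c hg => by
      refine (ggE_mul (ggE_mul (ggE_mul hm (ggE_part (s := Set.Iio i₀) h.2.2)) hV) hg).mono
        (le_of_eq ?_)
      push_cast
      ring)
    (by simp) ggE_one (by simp)
  refine ⟨mono (coeff f i₀)⁻¹ (-i₀) * V * y, ?_, ?_⟩
  · rw [AddMonoidHom.coe_mulLeft] at hy
    rw [← hy]
    nth_rewrite 1 [← part_Ici_add_part_Iio i₀ f]
    linear_combination y * hVinv
  · refine (ggE_mul (ggE_mul hm hV) hy0).mono (le_of_eq ?_)
    push_cast
    ring

/-- Weierstrass division. -/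
lemma IsLead.exists_division {f g : LaurE vK ν} {δ : ℚ} {z i₀ : ℤ} (hδ : 0 < δ)
    (h : IsLead f δ z i₀) :
    ∃ q ∈ SP vK ν, ∀ i ≥ i₀, coeff (g - f * q) i = 0 := by
  obtain ⟨V, hVP, hV, hVinv⟩ := h.exists_inv_part
  set a := coeff f i₀ with ha
  have ha0 : a ≠ 0 := h.ne_zero
  let τ : LaurE vK ν →+ LaurE vK ν :=
    (AddMonoidHom.mulLeft (mono 1 (-i₀))).comp (part (Set.Ici i₀))
  have hτ : ∀ x, τ x = mono 1 (-i₀) * part (Set.Ici i₀) x := fun x => rfl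
  have hτc : ∀ x n, coeff (τ x) n = if 0 ≤ n then coeff x (n + i₀) else 0 := fun x n => by
    rw [hτ, coeff_mono_mul, coeff_part, one_mul, sub_neg_eq_add]
    simp
  have hτg : ∀ x c, GGe vK ν (coeff x) c → GGe vK ν (coeff (τ x)) (c - ν * i₀) := by
    intro x c hx n
    rw [hτc]
    split_ifs with hn
    · refine (hx _).mono (le_of_eq ?_)
      push_cast
      ring
    · exact vge_zero _
  let L : LaurE vK ν := part (Set.Iio i₀) f * (mono a⁻¹ 0 * V)
  have hm := ggE_mono (ν := ν) (vge_val (val_inv (vK := vK) h.1)) 0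
  have hL : GGe vK ν (coeff L) (ν * i₀ + δ) := by
    refine (ggE_mul (ggE_part (s := Set.Iio i₀) h.2.2) (ggE_mul hm hV)).mono (le_of_eq ?_)
    push_cast
    ring
  obtain ⟨c, hc⟩ := (τ g).exists_ggE
  obtain ⟨y, hy, -, hyP⟩ := exists_add_eq (δ := δ) (J := Set.Iio 0) (c := c) (g := τ g)
    (τ.comp (AddMonoidHom.mulLeft L)) hδ
    (fun x c hx => (hτg _ _ (ggE_mul hL hx)).mono (le_of_eq (by ring)))
    (fun x _ i hi => by
      rw [AddMonoidHom.comp_apply, hτc, if_neg (not_le.2 hi)])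
    hc (fun i hi => by rw [hτc, if_neg (not_le.2 hi)])
  have hmP : mono a⁻¹ 0 ∈ SP vK ν := fun i hi => by rw [coeff_mono]; exact if_neg hi.ne
  refine ⟨mono a⁻¹ 0 * V * y, mul_mem (mul_mem hmP hVP) hyP, ?_⟩
  have hfq : f * (mono a⁻¹ 0 * V * y) = mono 1 i₀ * y + L * y := by
    have h1 : (mono a⁻¹ 0 : LaurE vK ν) = mono 1 i₀ * mono a⁻¹ (-i₀) := by
      rw [mono_mul_mono]; simp
    nth_rewrite 1 [← part_Ici_add_part_Iio i₀ f]
    change _ = _ + part (Set.Iio i₀) f * (mono a⁻¹ 0 * V) * y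
    rw [h1]
    linear_combination mono 1 i₀ * y * hVinv
  have hτy : τ (mono 1 i₀ * y) = y := ext fun n => by
    rw [hτc, coeff_mono_mul, one_mul, add_sub_cancel_right]
    split_ifs with hn
    · rfl
    · exact (hyP n (not_le.1 hn)).symm
  have hzero : τ (g - f * (mono a⁻¹ 0 * V * y)) = 0 := by
    rw [hfq, map_sub, map_add, hτy, ← hy]
    exact sub_self _
  intro i hi
  have := congrArg (fun x => coeff x (i - i₀)) hzero
  simpa [hτc, hi] using this

end Division

end Laurent.LaurE

namespace Laurent.LaurE

variable {vK : K → WithTop ℤ} {ν : ℚ} [hv : CompleteDVal vK]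

section Rings

variable {α : ℕ} {β : ℤ}

lemma isDomain (hα : 0 < α) (hν : ν = (β : ℚ) / (α : ℚ)) : IsDomain (LaurE vK ν) := by
  have : Nontrivial (LaurE vK ν) := ⟨1, 0, fun h => by
    have := congrArg (fun x => coeff x 0) h
    simp [coeff_one] at this⟩
  have : NoZeroDivisors (LaurE vK ν) := ⟨fun {f g} hfg => by
    by_contra! h
    obtain ⟨z, i₀, hl⟩ := exists_isLead hα hν h.1
    obtain ⟨f', hf', -⟩ := hl.exists_inv (by positivity)
    exact h.2 (by linear_combination f' * hfg - g * hf')⟩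
  exact NoZeroDivisors.to_isDomain _

lemma isPrincipalIdealRing_SP (hα : 0 < α) (hν : ν = (β : ℚ) / (α : ℚ)) :
    IsPrincipalIdealRing (SP vK ν) := by
  refine ⟨fun I => ?_⟩
  by_cases hI : I = ⊥
  · exact ⟨0, by simp [hI]⟩
  obtain ⟨f, hfI, hf0⟩ := Submodule.exists_mem_ne_zero_of_ne_bot hI
  obtain ⟨m, ⟨f, hfI, z, hlead⟩, hmin⟩ := Int.exists_least_of_bdd
    (P := fun m => ∃ f ∈ I, ∃ z, IsLead (f : LaurE vK ν) (1 / α) z m)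
    ⟨0, fun m ⟨f, _, z, h⟩ => by
      by_contra! hm
      exact h.ne_zero (f.2 m hm)⟩
    (by
      obtain ⟨z, m, h⟩ := exists_isLead hα hν (f := (f : LaurE vK ν)) (by simpa using hf0)
      exact ⟨m, f, hfI, z, h⟩)
  refine ⟨f, le_antisymm (fun g hg => ?_) ?_⟩
  · obtain ⟨q, hq, hqr⟩ := hlead.exists_division (g := (g : LaurE vK ν)) (by positivity)
    rw [Submodule.mem_span_singleton]
    refine ⟨⟨q, hq⟩, ?_⟩
    by_contra hne
    let r : SP vK ν := g - f * ⟨q, hq⟩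
    have hr : r ∈ I := sub_mem hg (I.mul_mem_right _ hfI)
    have hr0 : (r : LaurE vK ν) ≠ 0 := fun h => hne <| by
      have h' : r = 0 := Subtype.ext h
      rw [smul_eq_mul, mul_comm]
      exact (sub_eq_zero.1 h').symm
    obtain ⟨z', m', h'⟩ := exists_isLead hα hν hr0
    exact h'.ne_zero (hqr m' (hmin m' ⟨r, hr, z', h'⟩))
  · rw [Submodule.span_singleton_le_iff_mem]
    exact hfI

lemma isPrincipalIdealRing_SU (hα : 0 < α) (hν : ν = (β : ℚ) / (α : ℚ)) :
    IsPrincipalIdealRing (SU vK ν) := by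
  have hα' : (0 : ℚ) < α := by exact_mod_cast hα
  have hαν : α * ν = β := by rw [hν]; field_simp
  refine ⟨fun I => ?_⟩
  by_cases hI : I = ⊥
  · exact ⟨0, by simp [hI]⟩
  obtain ⟨f, hfI, hf0⟩ := Submodule.exists_mem_ne_zero_of_ne_bot hI
  obtain ⟨m, ⟨f, hfI, z, i₀, hlead, rfl⟩, hmin⟩ := Int.exists_least_of_bdd
    (P := fun m => ∃ f ∈ I, ∃ z i, IsLead (f : LaurE vK ν) (1 / α) z i ∧ α * z + β * i = m)
    ⟨0, by
      rintro m ⟨f, _, z, i, h, rfl⟩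
      have h1 := f.2 i z h.1
      have h2 : (0 : ℚ) ≤ α * (z + ν * i) := mul_nonneg hα'.le (by linarith)
      rw [mul_add, ← mul_assoc, hαν] at h2
      exact_mod_cast h2⟩
    (by
      obtain ⟨z, i, h⟩ := exists_isLead hα hν (f := (f : LaurE vK ν)) (by simpa using hf0)
      exact ⟨_, f, hfI, z, i, h, rfl⟩)
  refine ⟨f, le_antisymm (fun g hg => ?_) ?_⟩
  · obtain ⟨f', hff', hf'⟩ := hlead.exists_inv (by positivity)
    have hgv : GGe vK ν (coeff (g : LaurE vK ν)) (z + ν * i₀) := by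
      by_cases hg0 : g = 0
      · rw [hg0, Subring.coe_zero, map_zero]
        exact ggE_zero _
      obtain ⟨z', i', h'⟩ := exists_isLead hα hν (f := (g : LaurE vK ν)) (by simpa using hg0)
      refine h'.2.1.mono ?_
      have h1 : (α * z + β * i₀ : ℚ) ≤ α * z' + β * i' := by
        exact_mod_cast hmin _ ⟨g, hg, z', i', h', rfl⟩
      rw [← hαν] at h1
      exact le_of_mul_le_mul_left (by linarith) hα'
    have hq : f' * g ∈ SU vK ν := by
      have := ggE_mul hf' hgv
      rwa [neg_add_cancel] at this
    rw [Submodule.mem_span_singleton]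
    refine ⟨⟨f' * g, hq⟩, Subtype.ext ?_⟩
    simp only [smul_eq_mul, Subring.coe_mul]
    linear_combination (g : LaurE vK ν) * hff'
  · rw [Submodule.span_singleton_le_iff_mem]
    exact hfI

/-- The valuation ring of `K`. -/
def valRing (vK : K → WithTop ℤ) [hv : CompleteDVal vK] : Subring K where
  carrier := {a | VGe vK a 0}
  zero_mem' := vge_zero 0
  one_mem' := vge_val val_one
  add_mem' := fun ha hb => VGe.add ha hb
  neg_mem' := fun ha => VGe.neg ha
  mul_mem' := fun ha hb => by
    have := VGe.mul ha hb
    rwa [add_zero] at this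

lemma isPrincipalIdealRing_valRing : IsPrincipalIdealRing (valRing vK) := by
  refine ⟨fun I => ?_⟩
  by_cases hI : I = ⊥
  · exact ⟨0, by simp [hI]⟩
  obtain ⟨a, haI, ha0⟩ := Submodule.exists_mem_ne_zero_of_ne_bot hI
  obtain ⟨m, ⟨a, haI, hm⟩, hmin⟩ := Int.exists_least_of_bdd
    (P := fun m => ∃ a ∈ I, vK (a : K) = m)
    ⟨0, fun m ⟨a, _, h⟩ => by exact_mod_cast a.2 m h⟩
    (by
      obtain ⟨z, h⟩ := exists_val (vK := vK) (a := (a : K)) (by simpa using ha0)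
      exact ⟨z, a, haI, h⟩)
  refine ⟨a, le_antisymm (fun b hb => ?_) ?_⟩
  · rw [Submodule.mem_span_singleton]
    have hbm : VGe vK (b : K) m := fun z hz => by exact_mod_cast hmin z ⟨b, hb, hz⟩
    have hq : (a : K)⁻¹ * b ∈ valRing vK :=
      ((vge_val (val_inv (vK := vK) hm)).mul hbm).mono (by push_cast; linarith)
    have ha : (a : K) ≠ 0 := fun h => by
      rw [h, (hv.eq_top_iff 0).2 rfl] at hm
      exact WithTop.top_ne_coe hm
    refine ⟨⟨_, hq⟩, Subtype.ext ?_⟩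
    simp only [smul_eq_mul, Subring.coe_mul]
    field_simp
  · rw [Submodule.span_singleton_le_iff_mem]
    exact haI

variable {πK : K}

lemma pi_ne_zero (hπ : vK πK = (1 : ℤ)) : πK ≠ 0 := by
  rintro rfl
  rw [(hv.eq_top_iff 0).2 rfl] at hπ
  exact WithTop.top_ne_coe hπ

/-- The embedding `n ↦ α n` of exponents. -/
def mulNat (α : ℕ) (hα : 0 < α) : ℕ ↪o ℤ :=
  OrderEmbedding.ofMapLEIff (fun n : ℕ => (α : ℤ) * n) fun a b => by simp [hα]

/-- The substitution `X ↦ u^α/π^β` on Hahn series. -/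
def substHahn (vK : K → WithTop ℤ) [CompleteDVal vK] (πK : K) (α : ℕ) (β : ℤ) (hα : 0 < α) :
    PowerSeries (valRing vK) →+* HahnSeries ℤ K :=
  (HahnSeries.embDomainRingHom ((AddMonoidHom.mulLeft (α : ℤ)).comp (Nat.castAddMonoidHom ℤ))
    (mulNat α hα).injective fun _ _ => (mulNat α hα).le_iff_le).comp <|
    (HahnSeries.toPowerSeries (R := K)).symm.toRingHom.comp <|
      (PowerSeries.rescale (πK ^ (-β))).comp (PowerSeries.map (valRing vK).subtype)

lemma coeff_substHahn_mul (hα : 0 < α) (p : PowerSeries (valRing vK)) (n : ℕ) :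
    (substHahn vK πK α β hα p).coeff (α * n) =
      (πK ^ (-β)) ^ n * (PowerSeries.coeff n p : valRing vK) := by
  refine (HahnSeries.embDomain_coeff (f := mulNat α hα)
    (x := HahnSeries.toPowerSeries.symm (PowerSeries.rescale (πK ^ (-β))
      (PowerSeries.map (valRing vK).subtype p))) (a := n)).trans ?_
  rw [HahnSeries.coeff_toPowerSeries_symm, PowerSeries.coeff_rescale, PowerSeries.coeff_map]
  rfl

lemma coeff_substHahn_of_ne (hα : 0 < α) (p : PowerSeries (valRing vK)) {i : ℤ}
    (hi : ∀ n : ℕ, (α : ℤ) * n ≠ i) : (substHahn vK πK α β hα p).coeff i = 0 :=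
  HahnSeries.embDomain_of_notMem_range fun ⟨n, hn⟩ => hi n hn

lemma val_pi_zpow_pow (hπ : vK πK = (1 : ℤ)) (b : ℤ) (n : ℕ) :
    vK ((πK ^ b) ^ n) = ((b * n : ℤ) : WithTop ℤ) := by
  rw [← zpow_natCast, ← zpow_mul, val_zpow hπ]

lemma substHahn_mem (hα : 0 < α) (hν : ν = (β : ℚ) / (α : ℚ)) (hπ : vK πK = (1 : ℤ))
    (p : PowerSeries (valRing vK)) :
    (∀ i < 0, (substHahn vK πK α β hα p).coeff i = 0) ∧
      GGe vK ν (substHahn vK πK α β hα p).coeff 0 := by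
  have hα' : (0 : ℚ) < α := by exact_mod_cast hα
  have hαν : α * ν = β := by rw [hν]; field_simp
  refine ⟨fun i hi => coeff_substHahn_of_ne hα p fun n hn => ?_, fun i => ?_⟩
  · have : (0 : ℤ) ≤ α * n := by positivity
    omega
  · by_cases h : ∃ n : ℕ, (α : ℤ) * n = i
    · obtain ⟨n, rfl⟩ := h
      rw [coeff_substHahn_mul]
      refine ((vge_val (val_pi_zpow_pow hπ _ n)).mul (PowerSeries.coeff n p).2).mono (le_of_eq ?_)
      push_cast
      rw [← hαν]
      ring
    · push Not at h
      rw [coeff_substHahn_of_ne hα p h]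
      exact vge_zero _

/-- The substitution `X ↦ u^α/π^β`, with values in `S_ν`. -/
def subst (hα : 0 < α) (hν : ν = (β : ℚ) / (α : ℚ)) (hπ : vK πK = (1 : ℤ)) :
    PowerSeries (valRing vK) →+* SS vK ν where
  toFun p := ⟨mk (substHahn vK πK α β hα p).coeff 0 (substHahn_mem hα hν hπ p).2
    (tail_of_eq_zero (substHahn_mem hα hν hπ p).1), substHahn_mem hα hν hπ p⟩
  map_zero' := Subtype.ext (coeff_injective (by simp))
  map_one' := Subtype.ext (coeff_injective (by
    funext n
    simp only [map_one, coeff_mk, Subring.coe_one, coeff_one, HahnSeries.coeff_one]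
    split_ifs <;> rfl))
  map_add' p q := Subtype.ext (coeff_injective (by simp))
  map_mul' p q := Subtype.ext (coeff_injective (by
    rw [Subring.coe_mul, coeff_mul]
    simp only [coeff_mk]
    rw [mulL_coeff, map_mul]))

lemma coeff_subst (hα : 0 < α) (hν : ν = (β : ℚ) / (α : ℚ)) (hπ : vK πK = (1 : ℤ))
    (p : PowerSeries (valRing vK)) :
    coeff (subst hα hν hπ p : LaurE vK ν) = (substHahn vK πK α β hα p).coeff := rfl

lemma isNoetherianRing_SS (hα : 0 < α) (hν : ν = (β : ℚ) / (α : ℚ)) (hπ : vK πK = (1 : ℤ)) :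
    IsNoetherianRing (SS vK ν) := by
  have hα' : (0 : ℚ) < α := by exact_mod_cast hα
  have hαν : α * ν = β := by rw [hν]; field_simp
  have hπ0 := pi_ne_zero hπ
  have := isPrincipalIdealRing_valRing (vK := vK)
  let := (subst hα hν hπ).toAlgebra
  have hm : ∀ i : ℕ, (mono (πK ^ ⌈-ν * i⌉) i : LaurE vK ν) ∈ SS vK ν := fun i => by
    refine ⟨fun n hn => ?_, ?_⟩
    · rw [coeff_mono]
      exact if_neg (by omega)
    · refine (ggE_mono (vge_val (val_zpow hπ _)) _).mono ?_
      have := Int.le_ceil (-ν * i)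
      push_cast
      linarith
  let e : Fin α → SS vK ν := fun i => ⟨_, hm i⟩
  have hfin : Module.Finite (PowerSeries (valRing vK)) (SS vK ν) := by
    refine Module.finite_def.2 (Submodule.fg_def.2 ⟨Set.range e, Set.finite_range e, ?_⟩)
    refine eq_top_iff.2 fun f _ => ?_
    rw [Submodule.mem_span_range_iff_exists_fun]
    have hp : ∀ (i : Fin α) (n : ℕ),
        coeff (f : LaurE vK ν) (α * n + i) * (πK ^ β) ^ n * πK ^ (-⌈-ν * i⌉) ∈ valRing vK := by
      intro i n z hz
      by_cases hf0 : coeff (f : LaurE vK ν) (α * n + i) = 0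
      · rw [hf0, zero_mul, zero_mul, (hv.eq_top_iff 0).2 rfl] at hz
        exact absurd hz WithTop.top_ne_coe
      obtain ⟨y, hy⟩ := exists_val (vK := vK) hf0
      rw [hv.map_mul, hv.map_mul, hy, val_pi_zpow_pow hπ, val_zpow hπ] at hz
      have hz' : y + β * n + -⌈-ν * i⌉ = z := by exact_mod_cast hz
      have h1 := f.2.2 _ y hy
      have h2 : ⌈-ν * i⌉ ≤ y + β * n := by
        rw [Int.ceil_le]
        push_cast at h1 ⊢
        rw [← hαν]
        linarith
      have : 0 ≤ z := by omega
      exact_mod_cast this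
    refine ⟨fun i => PowerSeries.mk fun n => ⟨_, hp i n⟩, Subtype.ext (ext fun m => ?_)⟩
    simp only [Algebra.smul_def, RingHom.algebraMap_toAlgebra, AddSubmonoidClass.coe_finsetSum,
      map_sum, Finset.sum_apply, Subring.coe_mul, e]
    have hterm : ∀ (i : Fin α) (p : PowerSeries (valRing vK)),
        coeff ((subst hα hν hπ p : LaurE vK ν) * mono (πK ^ ⌈-ν * i⌉) (i : ℕ)) m =
          πK ^ ⌈-ν * i⌉ * (substHahn vK πK α β hα p).coeff (m - (i : ℕ)) := fun i p => by
      rw [mul_comm, coeff_mono_mul, coeff_subst]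
    simp only [hterm]
    rcases lt_or_ge m 0 with hm0 | hm0
    · rw [f.2.1 m hm0]
      refine Finset.sum_eq_zero fun i _ => ?_
      rw [(substHahn_mem hα hν hπ _).1 _ (by omega), mul_zero]
    · have hdiv := Int.mul_ediv_add_emod m α
      have hmod0 := Int.emod_nonneg m (b := α) (by omega)
      have hmodα := Int.emod_lt_of_pos m (b := α) (by omega)
      have hdiv0 : 0 ≤ m / (α : ℤ) := Int.ediv_nonneg hm0 (by omega)
      obtain ⟨n, hn⟩ := Int.eq_ofNat_of_zero_le hdiv0
      obtain ⟨r, hr⟩ := Int.eq_ofNat_of_zero_le hmod0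
      have hrα : r < α := by omega
      rw [hn, hr] at hdiv
      rw [Finset.sum_eq_single ⟨r, hrα⟩]
      · have h1 : m - (r : ℕ) = α * n := by omega
        simp only [h1, coeff_substHahn_mul, PowerSeries.coeff_mk]
        rw [← hdiv, zpow_neg, zpow_neg, inv_pow]
        have h2 : πK ^ ⌈-ν * (r : ℚ)⌉ ≠ 0 := zpow_ne_zero _ hπ0
        have h3 : (πK ^ β) ^ n ≠ 0 := pow_ne_zero _ (zpow_ne_zero _ hπ0)
        field_simp
      · intro i _ hi
        rw [coeff_substHahn_of_ne, mul_zero]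
        intro k hk
        refine hi (Fin.ext ?_)
        have h1 : m % α = i := by
          rw [← Int.emod_eq_of_lt (a := (i : ℤ)) (b := α) (by omega) (by omega),
            show m = i + α * k by omega, Int.add_mul_emod_self_left]
        have : (i : ℤ) = r := by rw [← h1, hr]
        exact_mod_cast this
      · intro h
        exact absurd (Finset.mem_univ _) h
  exact IsNoetherianRing.of_finite (PowerSeries (valRing vK)) (SS vK ν)

lemma mono_pow (a : K) (k : ℤ) (n : ℕ) : (mono a k : LaurE vK ν) ^ n = mono (a ^ n) (n * k) := by
  induction n with
  | zero => simp [one_def]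
  | succ n ih =>
    rw [pow_succ, ih, mono_mul_mono, pow_succ]
    congr 1
    push_cast
    ring

lemma mono_mem_SP (a : K) {k : ℤ} (hk : 0 ≤ k) : (mono a k : LaurE vK ν) ∈ SP vK ν := fun i hi => by
  rw [coeff_mono]
  exact if_neg (by omega)

lemma isGluing (hα : 0 < α) (hν : ν = (β : ℚ) / (α : ℚ)) (hπ : vK πK = (1 : ℤ)) :
    Gluing.IsGluing (SS vK ν) (SP vK ν) (SU vK ν) (mono πK 0) (mono (πK ^ (-β)) α) := by
  have hα' : (0 : ℚ) < α := by exact_mod_cast hα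
  have hαν : α * ν = β := by rw [hν]; field_simp
  have hπ0 := pi_ne_zero hπ
  refine ⟨fun e => mem_SS, ⟨mono_mem_SP _ le_rfl, ?_⟩, ⟨mono_mem_SP _ (by omega), ?_⟩,
    ⟨mono πK⁻¹ 0, mono_mem_SP _ le_rfl, ?_⟩, ⟨mono (πK ^ β) (-α), ?_, ?_⟩, fun e => ?_,
    fun e m => ?_⟩
  · exact (ggE_mono (vge_val hπ) 0).mono (by simp)
  · refine (ggE_mono (vge_val (val_zpow hπ _)) _).mono ?_
    push_cast
    linarith
  · rw [mono_mul_mono, inv_mul_cancel₀ hπ0, add_zero, one_def]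
  · refine (ggE_mono (vge_val (val_zpow hπ _)) _).mono ?_
    push_cast
    linarith
  · rw [mono_mul_mono, ← zpow_add₀ hπ0, one_def]
    simp
  · obtain ⟨c, hc⟩ := e.exists_ggE
    obtain ⟨n, hn⟩ := exists_nat_ge (-c)
    refine ⟨n, ?_⟩
    rw [mono_pow]
    refine (ggE_mul (ggE_mono (vge_val (z := n) ?_) _) hc).mono ?_
    · exact_mod_cast val_zpow hπ n
    · push_cast
      linarith
  · obtain ⟨N, hN⟩ := e.exists_part_Iic_ggE m
    refine ⟨mono (πK ^ (-m : ℤ)) 0 * part (Set.Iic N) e, ?_, N.natAbs, ?_⟩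
    · refine (ggE_mul (ggE_mono (vge_val (val_zpow hπ _)) _) hN).mono ?_
      push_cast
      linarith
    · have h : mono πK 0 ^ m * (mono (πK ^ (-m : ℤ)) 0 * part (Set.Iic N) e) =
          part (Set.Iic N) e := by
        rw [← mul_assoc, mono_pow, mono_mul_mono, ← zpow_natCast, ← zpow_add₀ hπ0]
        simp [← one_def]
      rw [h]
      nth_rewrite 1 [← part_Iic_add_part_Ioi N e]
      rw [add_sub_cancel_left, mono_pow]
      intro i hi
      rw [coeff_mono_mul, coeff_part, if_neg, mul_zero]
      have h1 : (N.natAbs : ℤ) * 1 ≤ N.natAbs * α := by gcongr; omega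
      simp only [Set.mem_Ioi, not_lt]
      omega

end Rings

end Laurent.LaurE

namespace Gluing

open Submodule

section Maximal

variable {E : Type*} [CommRing E] {S P U : Subring E} {π X : E} {d : ℕ}

lemma coords_of_mem_sup {R : Subring E} {N N' : Submodule R (Fin d → E)}
    (hN : ∀ x ∈ N, ∀ k, x k ∈ R) (hN' : ∀ x ∈ N', ∀ k, x k ∈ R) :
    ∀ x ∈ N ⊔ N', ∀ k, x k ∈ R := by
  intro x hx k
  obtain ⟨y, hy, z, hz, rfl⟩ := mem_sup.1 hx
  exact R.add_mem (hN y hy k) (hN' z hz k)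

lemma coords_of_mem_span {R R' : Subring E} (h : ∀ r ∈ R, r ∈ R') {N : Submodule R (Fin d → E)}
    (hN : ∀ x ∈ N, ∀ k, x k ∈ R) {x : Fin d → E} (hx : x ∈ span R' (N : Set (Fin d → E)))
    (k : Fin d) : x k ∈ R' := by
  induction hx using Submodule.span_induction with
  | mem x hx => exact h _ (hN x hx k)
  | zero => exact R'.zero_mem
  | add x y _ _ hx hy => exact R'.add_mem hx hy
  | smul r x _ hx => exact R'.mul_mem r.2 hx

namespace IsGluing

variable (hG : IsGluing S P U π X)
include hG

lemma coords_inter {A : Submodule P (Fin d → E)} {B : Submodule U (Fin d → E)}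
    (hA : ∀ x ∈ A, ∀ k, x k ∈ P) (hB : ∀ x ∈ B, ∀ k, x k ∈ U) :
    ∀ x ∈ hG.inter A B, ∀ k, x k ∈ S :=
  fun x hx k => (hG.mem_iff _).2 ⟨hA x hx.1 k, hB x hx.2 k⟩

/-- The maximal module attached to `N` is the intersection of `N_π` and `N_u`. -/
lemma mem_max_iff [IsNoetherianRing S] {N : Submodule S (Fin d → E)}
    (hN : ∀ x ∈ N, ∀ k, x k ∈ S) (x : Fin d → E) :
    ((∀ k, x k ∈ S) ∧ ∃ n : ℕ, π ^ n • x ∈ N ∧ X ^ n • x ∈ N) ↔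
      x ∈ hG.inter (span P (N : Set (Fin d → E))) (span U (N : Set (Fin d → E))) := by
  have hc := hG.coords_inter (fun x => coords_of_mem_span (fun _ => hG.memP) hN (x := x))
    (fun x => coords_of_mem_span (fun _ => hG.memU) hN (x := x))
  rw [← hG.mem_inter_span_iff (fg_of_coords hc)]
  exact ⟨fun h => h.2, fun h => ⟨hc x h, h⟩⟩

/-- An intersection `A ∩ B` is maximal. -/
lemma mem_inter_of_pow_smul_mem {A : Submodule P (Fin d → E)} {B : Submodule U (Fin d → E)}
    {x : Fin d → E} {n : ℕ} (h : π ^ n • x ∈ hG.inter A B) (h' : X ^ n • x ∈ hG.inter A B) :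
    x ∈ hG.inter A B :=
  ⟨mem_of_smul_mem A hG.exists_pi_inv n h.1, mem_of_smul_mem B hG.exists_X_inv n h'.2⟩

variable [IsDomain E] [IsPrincipalIdealRing P] [IsPrincipalIdealRing U]

lemma span_inter_inter {N N' : Submodule S (Fin d → E)}
    (hN : ∀ x ∈ N, ∀ k, x k ∈ S) (hN' : ∀ x ∈ N', ∀ k, x k ∈ S)
    (hmax : hG.inter (span P (N : Set (Fin d → E))) (span U (N : Set (Fin d → E))) = N)
    (hmax' : hG.inter (span P (N' : Set (Fin d → E))) (span U (N' : Set (Fin d → E))) = N') :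
    span P ((N : Set (Fin d → E)) ∩ N') = span P (N : Set (Fin d → E)) ⊓ span P N' ∧
      span U ((N : Set (Fin d → E)) ∩ N') = span U (N : Set (Fin d → E)) ⊓ span U N' := by
  have hEE : span E ((span P (N : Set (Fin d → E)) ⊓ span P N' :) : Set (Fin d → E)) =
      span E ((span U (N : Set (Fin d → E)) ⊓ span U N' :) : Set (Fin d → E)) := by
    refine le_antisymm (span_le.2 fun x hx => ?_) (span_le.2 fun x hx => ?_)
    · refine mem_span_inter_of_mem (fun _ => coords_of_mem_span (fun _ => hG.memU) hN)
        (fun _ => coords_of_mem_span (fun _ => hG.memU) hN') ?_ ?_ <;> rw [span_span_top]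
      exacts [span_le_span_top _ hx.1, span_le_span_top _ hx.2]
    · refine mem_span_inter_of_mem (fun _ => coords_of_mem_span (fun _ => hG.memP) hN)
        (fun _ => coords_of_mem_span (fun _ => hG.memP) hN') ?_ ?_ <;> rw [span_span_top]
      exacts [span_le_span_top _ hx.1, span_le_span_top _ hx.2]
  have h := hG.span_inter hEE
  have hNN : (N : Set (Fin d → E)) ∩ N' =
      ((span P (N : Set (Fin d → E)) ⊓ span P N' :) : Set (Fin d → E)) ∩
        ((span U (N : Set (Fin d → E)) ⊓ span U N' :) : Set (Fin d → E)) := by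
    have h1 : ∀ x, x ∈ N ↔ x ∈ span P (N : Set (Fin d → E)) ∧ x ∈ span U (N : Set (Fin d → E)) :=
      fun x => (SetLike.ext_iff.1 hmax x).symm
    have h2 : ∀ x, x ∈ N' ↔ x ∈ span P (N' : Set (Fin d → E)) ∧ x ∈ span U (N' : Set (Fin d → E)) :=
      fun x => (SetLike.ext_iff.1 hmax' x).symm
    ext x
    rw [Set.mem_inter_iff, SetLike.mem_coe, SetLike.mem_coe, h1, h2]
    exact and_and_and_comm
  rw [hNN]
  exact h

omit [IsDomain E] [IsPrincipalIdealRing P] [IsPrincipalIdealRing U] in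
lemma span_max_sup (N N' : Submodule S (Fin d → E)) :
    span P (hG.inter (span P ((N ⊔ N' :) : Set (Fin d → E)))
        (span U ((N ⊔ N' :) : Set (Fin d → E))) : Set (Fin d → E)) =
          span P (N : Set (Fin d → E)) ⊔ span P N' ∧
      span U (hG.inter (span P ((N ⊔ N' :) : Set (Fin d → E)))
        (span U ((N ⊔ N' :) : Set (Fin d → E))) : Set (Fin d → E)) =
          span U (N : Set (Fin d → E)) ⊔ span U N' := by
  have hsup : ∀ R : Subring E, (∀ r ∈ S, r ∈ R) → span R ((N ⊔ N' :) : Set (Fin d → E)) =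
      span R (N : Set (Fin d → E)) ⊔ span R N' := by
    intro R hR
    refine le_antisymm (span_le.2 fun x hx => ?_) (sup_le ?_ ?_)
    · obtain ⟨y, hy, z, hz, rfl⟩ := mem_sup.1 hx
      exact add_mem_sup (subset_span hy) (subset_span hz)
    · exact span_mono (SetLike.coe_subset_coe.2 le_sup_left)
    · exact span_mono (SetLike.coe_subset_coe.2 le_sup_right)
  rw [← hsup P fun _ => hG.memP, ← hsup U fun _ => hG.memU]
  exact hG.span_inter (by rw [span_span_top, span_span_top])

end IsGluing

end Maximal

end Gluing

namespace Laurent.LaurE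

open Submodule

variable {vK : K → WithTop ℤ} {ν : ℚ} [hv : CompleteDVal vK] {d : ℕ}

section Vectors

/-- The coefficients of a vector of Laurent series. -/
def coeffs : (Fin d → LaurE vK ν) →+ (Fin d → ℤ → K) where
  toFun x k := coeff (x k)
  map_zero' := by
    funext k
    simp
  map_add' x y := by
    funext k
    simp

lemma coeffs_apply (x : Fin d → LaurE vK ν) (k : Fin d) : coeffs x k = coeff (x k) := rfl

lemma coeffs_injective : Function.Injective (coeffs : (Fin d → LaurE vK ν) → Fin d → ℤ → K) :=
  fun _ _ h => funext fun k => coeff_injective (congrFun h k)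

lemma smulV_coeffs (r : LaurE vK ν) (x : Fin d → LaurE vK ν) :
    smulV vK (coeff r) (coeffs x) = coeffs (r • x) := rfl

lemma sum_mulL_coeffs {m : ℕ} (r : Fin m → LaurE vK ν) (v : Fin m → Fin d → LaurE vK ν) :
    (fun k n => ∑ j, mulL vK (coeff (r j)) (coeffs (v j) k) n) = coeffs (∑ j, r j • v j) := by
  funext k n
  rw [coeffs_apply, Finset.sum_apply, map_sum, Finset.sum_apply]
  rfl

lemma spanL_image (R : Subring (LaurE vK ν)) (Y : Set (Fin d → LaurE vK ν)) :
    SpanL vK d (coeff '' (R : Set (LaurE vK ν))) (coeffs '' Y) =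
      coeffs '' (span R Y : Set (Fin d → LaurE vK ν)) := by
  ext y
  constructor
  · rintro ⟨m, r, v, hr, hv', rfl⟩
    choose r' hr' hrr using hr
    choose v' hv' hvv using hv'
    obtain rfl : (fun j => coeff (r' j)) = r := funext hrr
    obtain rfl : (fun j => coeffs (v' j)) = v := funext hvv
    exact ⟨_, sum_mem fun j _ => (span R Y).smul_mem (⟨r' j, hr' j⟩ : R) (subset_span (hv' j)),
      (sum_mulL_coeffs r' v').symm⟩
  · rintro ⟨x, hx, rfl⟩
    obtain ⟨m, r, v, rfl⟩ := mem_span_set'.1 hx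
    exact ⟨m, fun j => coeff (r j : LaurE vK ν), fun j => coeffs (v j).1,
      fun j => ⟨_, (r j).2, rfl⟩, fun j => ⟨_, (v j).2, rfl⟩,
      (sum_mulL_coeffs (fun j => (r j : LaurE vK ν)) fun j => (v j).1).symm⟩

lemma spanL_ELSet_image (Y : Set (Fin d → LaurE vK ν)) :
    SpanL vK d (ELSet vK ν) (coeffs '' Y) =
      coeffs '' (span (LaurE vK ν) Y : Set (Fin d → LaurE vK ν)) := by
  have h : ELSet vK ν = coeff '' ((⊤ : Subring (LaurE vK ν)) : Set (LaurE vK ν)) := by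
    rw [← range_coeff, Subring.coe_top, Set.image_univ]
  rw [h, spanL_image]
  congr 1
  refine Set.Subset.antisymm (fun x hx => Gluing.IsGluing.span_le_span_top _ hx) fun x hx => ?_
  induction hx using Submodule.span_induction with
  | mem x hx => exact subset_span hx
  | zero => exact Submodule.zero_mem _
  | add x y _ _ hx hy => exact Submodule.add_mem _ hx hy
  | smul r x _ hx => exact Gluing.smul_mem_of_mem _ (Subring.mem_top r) hx

lemma isSubmodL_image {R : Subring (LaurE vK ν)} (N : Submodule R (Fin d → LaurE vK ν)) :
    IsSubmodL vK d (coeff '' (R : Set (LaurE vK ν)))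
      (coeffs '' (N : Set (Fin d → LaurE vK ν))) := by
  refine ⟨⟨0, N.zero_mem, map_zero _⟩, ?_, ?_⟩
  · rintro _ ⟨x, hx, rfl⟩ _ ⟨y, hy, rfl⟩
    exact ⟨x + y, N.add_mem hx hy, map_add _ _ _⟩
  · rintro _ ⟨r, hr, rfl⟩ _ ⟨x, hx, rfl⟩
    exact ⟨r • x, Gluing.smul_mem_of_mem N hr hx, rfl⟩

lemma exists_submodule {R : Subring (LaurE vK ν)} {A : Set (Fin d → ℤ → K)}
    (hA : ∀ x ∈ A, ∀ k, x k ∈ coeff '' (R : Set (LaurE vK ν)))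
    (h : IsSubmodL vK d (coeff '' (R : Set (LaurE vK ν))) A) :
    ∃ N : Submodule R (Fin d → LaurE vK ν), A = coeffs '' (N : Set (Fin d → LaurE vK ν)) ∧
      ∀ x ∈ N, ∀ k, x k ∈ R := by
  let N : Submodule R (Fin d → LaurE vK ν) :=
    { carrier := coeffs ⁻¹' A
      zero_mem' := by
        rw [Set.mem_preimage, map_zero]
        exact h.1
      add_mem' := fun {x y} hx hy => by
        rw [Set.mem_preimage, map_add]
        exact h.2.1 _ hx _ hy
      smul_mem' := fun r x hx => h.2.2 _ ⟨r, r.2, rfl⟩ _ hx }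
  refine ⟨N, ?_, fun x hx k => ?_⟩
  · refine (Set.image_preimage_eq_of_subset fun x hx => ?_).symm
    choose y hy hyx using hA x hx
    exact ⟨y, funext hyx⟩
  · obtain ⟨r, hr, h'⟩ := hA _ hx k
    rwa [← coeff_injective h']

lemma isFreeL_image [IsDomain (LaurE vK ν)] {R : Subring (LaurE vK ν)} [IsPrincipalIdealRing R]
    {L : Submodule R (Fin d → LaurE vK ν)} (hL : ∀ x ∈ L, ∀ k, x k ∈ R) :
    IsFreeL vK d (coeff '' (R : Set (LaurE vK ν))) (coeffs '' (L : Set (Fin d → LaurE vK ν))) := by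
  obtain ⟨n, b, rfl, hb⟩ := Gluing.exists_basis_of_coords hL
  refine ⟨n, fun j => coeffs (b j), fun j => ⟨_, subset_span ⟨j, rfl⟩, rfl⟩, ?_, ?_⟩
  · rw [← spanL_image, ← Set.range_comp]
    rfl
  · intro r hr h0
    choose r' hr' hrr using hr
    obtain rfl : (fun j => coeff (r' j)) = r := funext hrr
    rw [sum_mulL_coeffs] at h0
    have h1 : ∑ j, r' j • b j = 0 :=
      coeffs_injective (h0.trans (map_zero (coeffs : (Fin d → LaurE vK ν) →+ _)).symm)
    intro j
    have h2 := Fintype.linearIndependent_iff.1 hb (fun j => ⟨r' j, hr' j⟩) h1 j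
    have h3 : r' j = 0 := congrArg Subtype.val h2
    simp only [h3, map_zero]
    rfl

lemma sumV_image {R : Subring (LaurE vK ν)} (N N' : Submodule R (Fin d → LaurE vK ν)) :
    sumV (coeffs '' (N : Set (Fin d → LaurE vK ν))) (coeffs '' (N' : Set (Fin d → LaurE vK ν))) =
      coeffs '' ((N ⊔ N' :) : Set (Fin d → LaurE vK ν)) := by
  ext y
  constructor
  · rintro ⟨_, ⟨x, hx, rfl⟩, _, ⟨x', hx', rfl⟩, rfl⟩
    exact ⟨x + x', add_mem_sup hx hx', map_add _ _ _⟩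
  · rintro ⟨x, hx, rfl⟩
    obtain ⟨y, hy, z, hz, rfl⟩ := mem_sup.1 hx
    exact ⟨_, ⟨y, hy, rfl⟩, _, ⟨z, hz, rfl⟩, map_add _ _ _⟩

lemma powL_coeff (f : LaurE vK ν) (n : ℕ) : powL vK (coeff f) n = coeff (f ^ n) := by
  induction n with
  | zero => rw [pow_zero]; rfl
  | succ n ih => rw [pow_succ', coeff_mul, ← ih]; rfl

variable {α : ℕ} {β : ℤ} {πK : K}

lemma maxOfL_image (Y : Set (Fin d → LaurE vK ν)) :
    MaxOfL vK ν d πK α β (coeffs '' Y) = coeffs '' {x | (∀ k, x k ∈ SS vK ν) ∧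
      ∃ n : ℕ, (mono πK 0 : LaurE vK ν) ^ n • x ∈ Y ∧
        (mono (πK ^ (-β)) α : LaurE vK ν) ^ n • x ∈ Y} := by
  have hpow : ∀ (n : ℕ) (x : Fin d → LaurE vK ν),
      (smulV vK (powL vK (piL πK) n) (coeffs x) ∈ coeffs '' Y ↔
        (mono πK 0 : LaurE vK ν) ^ n • x ∈ Y) ∧
      (smulV vK (powL vK (wLs πK α β) n) (coeffs x) ∈ coeffs '' Y ↔
        (mono (πK ^ (-β)) α : LaurE vK ν) ^ n • x ∈ Y) := by
    intro n x
    have h1 : piL πK = coeff (mono πK 0 : LaurE vK ν) := rfl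
    have h2 : wLs πK α β = coeff (mono (πK ^ (-β)) α : LaurE vK ν) := rfl
    rw [h1, h2, powL_coeff, powL_coeff, smulV_coeffs, smulV_coeffs,
      coeffs_injective.mem_set_image, coeffs_injective.mem_set_image]
    exact ⟨Iff.rfl, Iff.rfl⟩
  ext y
  constructor
  · rintro ⟨hy, n, h, h'⟩
    rw [← image_coeff_SS] at hy
    choose x hx hxy using hy
    obtain rfl : coeffs x = y := funext hxy
    exact ⟨x, ⟨hx, n, (hpow n x).1.1 h, (hpow n x).2.1 h'⟩, rfl⟩
  · rintro ⟨x, ⟨hx, n, h, h'⟩, rfl⟩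
    refine ⟨fun k => ?_, n, (hpow n x).1.2 h, (hpow n x).2.2 h'⟩
    rw [← image_coeff_SS]
    exact ⟨_, hx k, rfl⟩

end Vectors

section Maximal

variable {α : ℕ} {β : ℤ} {πK : K} [IsNoetherianRing (SS vK ν)]
  (hG : Gluing.IsGluing (SS vK ν) (SP vK ν) (SU vK ν) (mono πK 0) (mono (πK ^ (-β)) α))

include hG

lemma maxOfL_image_submodule {N : Submodule (SS vK ν) (Fin d → LaurE vK ν)}
    (hN : ∀ x ∈ N, ∀ k, x k ∈ SS vK ν) :
    MaxOfL vK ν d πK α β (coeffs '' (N : Set (Fin d → LaurE vK ν))) =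
      coeffs '' (hG.inter (span (SP vK ν) (N : Set (Fin d → LaurE vK ν)))
        (span (SU vK ν) (N : Set (Fin d → LaurE vK ν))) : Set (Fin d → LaurE vK ν)) := by
  rw [maxOfL_image]
  congr 1
  ext x
  exact hG.mem_max_iff hN x

lemma exists_of_isMaxSubL {M : Set (Fin d → ℤ → K)} (hM : IsMaxSubL vK ν d πK α β M) :
    ∃ N : Submodule (SS vK ν) (Fin d → LaurE vK ν), M = coeffs '' (N : Set (Fin d → LaurE vK ν)) ∧
      (∀ x ∈ N, ∀ k, x k ∈ SS vK ν) ∧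
      hG.inter (span (SP vK ν) (N : Set (Fin d → LaurE vK ν)))
        (span (SU vK ν) (N : Set (Fin d → LaurE vK ν))) = N := by
  obtain ⟨hc, hsub, -, hmax⟩ := hM
  rw [← image_coeff_SS] at hc hsub
  obtain ⟨N, rfl, hN⟩ := exists_submodule hc hsub
  rw [maxOfL_image_submodule hG hN] at hmax
  exact ⟨N, rfl, hN, SetLike.coe_injective (coeffs_injective.image_injective hmax).symm⟩

lemma isMaxSubL_inter {A : Submodule (SP vK ν) (Fin d → LaurE vK ν)}
    {B : Submodule (SU vK ν) (Fin d → LaurE vK ν)}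
    (hA : ∀ x ∈ A, ∀ k, x k ∈ SP vK ν) (hB : ∀ x ∈ B, ∀ k, x k ∈ SU vK ν) :
    IsMaxSubL vK ν d πK α β (coeffs '' (hG.inter A B : Set (Fin d → LaurE vK ν))) := by
  have hc := hG.coords_inter hA hB
  obtain ⟨n, b, hb⟩ := fg_iff_exists_fin_generating_family.1 (Gluing.fg_of_coords hc)
  refine ⟨?_, ?_, ⟨n, fun j => coeffs (b j), fun j => ⟨_, ?_, rfl⟩, ?_⟩, ?_⟩
  · rw [← image_coeff_SS]
    rintro _ ⟨x, hx, rfl⟩ k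
    exact ⟨_, hc x hx k, rfl⟩
  · rw [← image_coeff_SS]
    exact isSubmodL_image _
  · rw [← hb]
    exact subset_span ⟨j, rfl⟩
  · rw [← hb, ← spanL_image, ← Set.range_comp, image_coeff_SS]
    rfl
  · rw [maxOfL_image]
    congr 1
    ext x
    refine ⟨fun hx => ⟨hc x hx, 0, ?_, ?_⟩, fun ⟨_, n, h, h'⟩ => hG.mem_inter_of_pow_smul_mem h h'⟩
      <;> simpa using hx

end Maximal

end Laurent.LaurE

open Laurent.LaurE

/-- **Statement 14.** The map `Ψ : M ↦ (M_π, M_u)` on maximal submodules of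
`S_ν^d`: (i) `M_π` and `M_u` are free and generate the same `E`-subspace of
`E^d`; (ii) `Ψ` is injective; (iii) every pair `(A, B)` of free submodules of
`S_{ν,π}^d` and `S_{ν,u}^d` generating the same `E`-subspace is the image of the
maximal module `A ∩ B`, its unique preimage; (iv) `Ψ(M ∩ M') = (M_π ∩ M'_π,
M_u ∩ M'_u)` and `Ψ(Max(M + M')) = (M_π + M'_π, M_u + M'_u)`. -/
theorem statement14
    (vK : K → WithTop ℤ)
    (hv_zero : ∀ x : K, vK x = ⊤ ↔ x = 0)
    (hv_mul : ∀ x y : K, vK (x * y) = vK x + vK y)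
    (hv_add : ∀ x y : K, min (vK x) (vK y) ≤ vK (x + y))
    (hv_surj : Function.Surjective vK)
    (hv_complete : ∀ x : ℕ → K,
      (∀ n : ℕ, ((n : ℤ) : WithTop ℤ) ≤ vK (x (n + 1) - x n)) →
      ∃ l : K, ∀ n : ℕ, ((n : ℤ) : WithTop ℤ) ≤ vK (l - x n))
    (ν : ℚ)
    (α : ℕ) (β : ℤ) (hα : 0 < α) (hcop : Int.gcd (α : ℤ) β = 1)
    (hν : ν = (β : ℚ) / (α : ℚ))
    (πK : K) (hπ : vK πK = (1 : ℤ))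
    (d : ℕ) (hd : 0 < d)
    (M M' : Set (Fin d → ℤ → K))
    (hM : IsMaxSubL vK ν d πK α β M)
    (hM' : IsMaxSubL vK ν d πK α β M') :
    (IsFreeL vK d (SnupiLSet vK ν) (SpanL vK d (SnupiLSet vK ν) M) ∧
      IsFreeL vK d (SnuuLSet vK ν) (SpanL vK d (SnuuLSet vK ν) M) ∧
      SpanL vK d (ELSet vK ν) (SpanL vK d (SnupiLSet vK ν) M) =
        SpanL vK d (ELSet vK ν) (SpanL vK d (SnuuLSet vK ν) M)) ∧
    (SpanL vK d (SnupiLSet vK ν) M = SpanL vK d (SnupiLSet vK ν) M' →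
      SpanL vK d (SnuuLSet vK ν) M = SpanL vK d (SnuuLSet vK ν) M' →
      M = M') ∧
    (∀ A B : Set (Fin d → ℤ → K),
      (∀ x ∈ A, ∀ k, x k ∈ SnupiLSet vK ν) →
      IsSubmodL vK d (SnupiLSet vK ν) A → IsFreeL vK d (SnupiLSet vK ν) A →
      (∀ x ∈ B, ∀ k, x k ∈ SnuuLSet vK ν) →
      IsSubmodL vK d (SnuuLSet vK ν) B → IsFreeL vK d (SnuuLSet vK ν) B →
      SpanL vK d (ELSet vK ν) A = SpanL vK d (ELSet vK ν) B →
      (IsMaxSubL vK ν d πK α β (A ∩ B) ∧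
        SpanL vK d (SnupiLSet vK ν) (A ∩ B) = A ∧
        SpanL vK d (SnuuLSet vK ν) (A ∩ B) = B)) ∧
    (SpanL vK d (SnupiLSet vK ν) (M ∩ M') =
        SpanL vK d (SnupiLSet vK ν) M ∩ SpanL vK d (SnupiLSet vK ν) M' ∧
      SpanL vK d (SnuuLSet vK ν) (M ∩ M') =
        SpanL vK d (SnuuLSet vK ν) M ∩ SpanL vK d (SnuuLSet vK ν) M') ∧
    (SpanL vK d (SnupiLSet vK ν) (MaxOfL vK ν d πK α β (sumV M M')) =
        sumV (SpanL vK d (SnupiLSet vK ν) M) (SpanL vK d (SnupiLSet vK ν) M') ∧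
      SpanL vK d (SnuuLSet vK ν) (MaxOfL vK ν d πK α β (sumV M M')) =
        sumV (SpanL vK d (SnuuLSet vK ν) M) (SpanL vK d (SnuuLSet vK ν) M')) := by
  have : CompleteDVal vK := ⟨hv_zero, hv_mul, hv_add, hv_complete⟩
  have := Laurent.LaurE.isDomain (vK := vK) hα hν
  have := Laurent.LaurE.isPrincipalIdealRing_SP (vK := vK) hα hν
  have := Laurent.LaurE.isPrincipalIdealRing_SU (vK := vK) hα hν
  have := Laurent.LaurE.isNoetherianRing_SS hα hν hπ
  have hG := Laurent.LaurE.isGluing hα hν hπ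
  obtain ⟨N, rfl, hN, hmax⟩ := exists_of_isMaxSubL hG hM
  obtain ⟨N', rfl, hN', hmax'⟩ := exists_of_isMaxSubL hG hM'
  rw [← image_coeff_SP, ← image_coeff_SU, sumV_image,
    maxOfL_image_submodule hG (Gluing.coords_of_mem_sup hN hN'),
    ← Set.image_inter coeffs_injective]
  simp only [spanL_image, spanL_ELSet_image, Gluing.IsGluing.span_span_top, sumV_image]
  refine ⟨⟨isFreeL_image (fun _ => Gluing.coords_of_mem_span (fun _ => hG.memP) hN),
    isFreeL_image (fun _ => Gluing.coords_of_mem_span (fun _ => hG.memU) hN), trivial⟩,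
    fun hP hU => ?_, ?_, ?_, ?_⟩
  · have hP' := SetLike.coe_injective (coeffs_injective.image_injective hP)
    have hU' := SetLike.coe_injective (coeffs_injective.image_injective hU)
    rw [← hmax, ← hmax', hP', hU']
  · intro A B hA hAs _ hB hBs _ hAB
    obtain ⟨A, rfl, hA'⟩ := exists_submodule hA hAs
    obtain ⟨B, rfl, hB'⟩ := exists_submodule hB hBs
    rw [spanL_ELSet_image, spanL_ELSet_image] at hAB
    have hAB' := SetLike.coe_injective (coeffs_injective.image_injective hAB)
    obtain ⟨h1, h2⟩ := hG.span_inter hAB'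
    rw [← Set.image_inter coeffs_injective]
    refine ⟨isMaxSubL_inter hG hA' hB', ?_, ?_⟩
    · rw [spanL_image, h1]
    · rw [spanL_image, h2]
  · obtain ⟨h1, h2⟩ := hG.span_inter_inter hN hN' hmax hmax'
    rw [h1, h2, ← Set.image_inter coeffs_injective, ← Set.image_inter coeffs_injective]
    exact ⟨rfl, rfl⟩
  · obtain ⟨h1, h2⟩ := hG.span_max_sup N N'
    rw [h1, h2]
    exact ⟨rfl, rfl⟩
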